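/- arXiv:2504.10722 — 8 statements merged into one kernel-verified Lean document; each statement's English description precedes it below -/
import Mathlib

section
/- An integral domain D is a GL-domain if and only if for all nonzero elements r, s, t of D, if every common divisor of r and s is a unit and every common divisor of r and t is a unit, then every common divisor of r and st is a unit. -/
/-- A polynomial over `D` is primitive if every element of `D` dividing all of its
coefficients is a unit. -/
def IsPrimitivePoly {D : Type*} [CommRing D] (f : Polynomial D) : Prop :=
  ∀ d : D, (∀ n : ℕ, d ∣ f.coeff n) → IsUnit d

/-- `D` is a GL-domain if the product of any two primitive polynomials over `D` is
again primitive. -/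
def IsGLDomain (D : Type*) [CommRing D] : Prop :=
  ∀ f g : Polynomial D, IsPrimitivePoly f → IsPrimitivePoly g → IsPrimitivePoly (f * g)

open Polynomial in
/-- If coprimality to a fixed element is preserved by products, then a nonunit dividing `f * g`
has a nonunit divisor dividing `f` or `g`. -/
theorem exists_nonunit_dvd_of_C_dvd_mul {D : Type*} [CommRing D] [IsDomain D]
    (h : ∀ r s t : D, r ≠ 0 → s ≠ 0 → t ≠ 0 →
      (∀ d : D, d ∣ r → d ∣ s → IsUnit d) → (∀ d : D, d ∣ r → d ∣ t → IsUnit d) →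
      ∀ d : D, d ∣ r → d ∣ s * t → IsUnit d)
    (f g : D[X]) {d : D} (hd0 : d ≠ 0) (hd : ¬IsUnit d) (hfg : C d ∣ f * g) :
    ∃ e, e ∣ d ∧ ¬IsUnit e ∧ (C e ∣ f ∨ C e ∣ g) := by
  induction hn : f.support.card + g.support.card using Nat.strong_induction_on
    generalizing f g d with
  | _ n ih =>
    by_cases hf : f = 0
    · exact ⟨d, dvd_rfl, hd, .inl (hf ▸ dvd_zero _)⟩
    by_cases hg : g = 0
    · exact ⟨d, dvd_rfl, hd, .inr (hg ▸ dvd_zero _)⟩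
    have hlead : d ∣ f.leadingCoeff * g.leadingCoeff := by
      rw [← leadingCoeff_mul]
      exact (C_dvd_iff_dvd_coeff _ _).1 hfg _
    have erase_dvd : ∀ {p : D[X]} {e : D}, e ∣ p.leadingCoeff → (C e ∣ p.eraseLead ↔ C e ∣ p) := by
      intro p e he
      have hC : C e ∣ C p.leadingCoeff * X ^ p.natDegree := (map_dvd C he).mul_right _
      conv_rhs => rw [← p.eraseLead_add_C_mul_X_pow]
      exact (dvd_add_left hC).symm
    obtain ⟨e, hed, heu, he⟩ : ∃ e, e ∣ d ∧ ¬IsUnit e ∧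
        (e ∣ f.leadingCoeff ∨ e ∣ g.leadingCoeff) := by
      by_contra! hcon
      refine hd (h d _ _ hd0 (leadingCoeff_ne_zero.2 hf) (leadingCoeff_ne_zero.2 hg)
        (fun e h₁ h₂ => ?_) (fun e h₁ h₂ => ?_) d dvd_rfl hlead)
      · by_contra hu
        exact (hcon e h₁ hu).1 h₂
      · by_contra hu
        exact (hcon e h₁ hu).2 h₂
    have he0 : e ≠ 0 := ne_zero_of_dvd_ne_zero hd0 hed
    have hefg : C e ∣ f * g := (map_dvd C hed).trans hfg
    rcases he with he | he
    · have hmul : C e ∣ f.eraseLead * g := by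
        rw [← f.eraseLead_add_C_mul_X_pow, add_mul] at hefg
        exact (dvd_add_left (((map_dvd C he).mul_right _).mul_right _)).1 hefg
      obtain ⟨e', h₁, hu, h₂⟩ := ih _ (by have := eraseLead_support_card_lt hf; omega)
        f.eraseLead g he0 heu hmul rfl
      exact ⟨e', h₁.trans hed, hu, h₂.imp_left (erase_dvd (h₁.trans he)).1⟩
    · have hmul : C e ∣ f * g.eraseLead := by
        rw [← g.eraseLead_add_C_mul_X_pow, mul_add] at hefg
        exact (dvd_add_left (((map_dvd C he).mul_right _).mul_left _)).1 hefg
      obtain ⟨e', h₁, hu, h₂⟩ := ih _ (by have := eraseLead_support_card_lt hg; omega)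
        f g.eraseLead he0 heu hmul rfl
      exact ⟨e', h₁.trans hed, hu, h₂.imp_right (erase_dvd (h₁.trans he)).1⟩

open Polynomial in
theorem isPrimitivePoly_C_add_C_mul_X {D : Type*} [CommRing D] {r s : D}
    (h : ∀ d : D, d ∣ r → d ∣ s → IsUnit d) : IsPrimitivePoly (C r + C s * X) :=
  fun d hd => h d (by simpa using hd 0) (by simpa using hd 1)

open Polynomial in
theorem IsPrimitivePoly.ne_zero {D : Type*} [CommRing D] [Nontrivial D] {f : D[X]}
    (hf : IsPrimitivePoly f) : f ≠ 0 := by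
  rintro rfl
  exact not_isUnit_zero (hf 0 (by simp))

theorem stmt0 {D : Type*} [CommRing D] [IsDomain D] :
    IsGLDomain D ↔
      ∀ r s t : D, r ≠ 0 → s ≠ 0 → t ≠ 0 →
        (∀ d : D, d ∣ r → d ∣ s → IsUnit d) →
        (∀ d : D, d ∣ r → d ∣ t → IsUnit d) →
        ∀ d : D, d ∣ r → d ∣ s * t → IsUnit d := by
  open Polynomial in
  constructor
  · intro hGL r s t _ _ _ hrs hrt d hdr hdst
    refine hGL _ _ (isPrimitivePoly_C_add_C_mul_X hrs) (isPrimitivePoly_C_add_C_mul_X hrt) d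
      ((C_dvd_iff_dvd_coeff _ _).1 ?_)
    have hexpand : (C r + C s * X) * (C r + C t * X) =
        C r * (C r + (C s + C t) * X) + C (s * t) * X ^ 2 := by
      rw [C_mul]
      ring
    rw [hexpand]
    exact dvd_add ((map_dvd C hdr).mul_right _) ((map_dvd C hdst).mul_right _)
  · intro h f g hf hg d hd
    by_contra hdu
    have hfg : C d ∣ f * g := (C_dvd_iff_dvd_coeff _ _).2 hd
    have hd0 : d ≠ 0 := by
      rintro rfl
      rw [C_0, zero_dvd_iff] at hfg
      exact mul_ne_zero hf.ne_zero hg.ne_zero hfg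
    obtain ⟨e, -, heu, he | he⟩ := exists_nonunit_dvd_of_C_dvd_mul h f g hd0 hdu hfg
    · exact heu (hf e ((C_dvd_iff_dvd_coeff _ _).1 he))
    · exact heu (hg e ((C_dvd_iff_dvd_coeff _ _).1 he))
end

section
/- Let D be an MCD-domain. Then D is a pre-Schreier domain if and only if D is a GL-domain. -/
/-- `d` is a maximal common divisor of the finite set `S`: it is a common divisor of `S`
and every common divisor of `S` divisible by `d` is an associate of `d`. -/
def IsMCDOf {D : Type*} [CommRing D] (d : D) (S : Finset D) : Prop :=
  (∀ s ∈ S, d ∣ s) ∧ ∀ d' : D, (∀ s ∈ S, d' ∣ s) → d ∣ d' → Associated d d'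

/-- `D` is an MCD-domain if every nonempty finite set of nonzero elements of `D`
has a maximal common divisor. -/
def IsMCDDomain (D : Type*) [CommRing D] : Prop :=
  ∀ S : Finset D, S.Nonempty → (∀ s ∈ S, s ≠ 0) → ∃ d : D, IsMCDOf d S

/-- A nonzero element `p` is primal if whenever `p ∣ r * s` we can write `p = p₁ * p₂`
with `p₁ ∣ r` and `p₂ ∣ s`. -/
def IsPrimalElem {D : Type*} [CommRing D] (p : D) : Prop :=
  ∀ r s : D, p ∣ r * s → ∃ p₁ p₂ : D, p = p₁ * p₂ ∧ p₁ ∣ r ∧ p₂ ∣ s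

/-- `D` is pre-Schreier if every nonzero nonunit of `D` is primal. -/
def IsPreSchreier (D : Type*) [CommRing D] : Prop :=
  ∀ p : D, p ≠ 0 → ¬ IsUnit p → IsPrimalElem p

theorem IsPreSchreier.isPrimalElem {D : Type*} [CommRing D] [IsDomain D]
    (h : IsPreSchreier D) (p : D) : IsPrimalElem p := by
  intro r s hrs
  by_cases hp : p = 0
  · subst hp
    rcases mul_eq_zero.mp (zero_dvd_iff.mp hrs) with rfl | rfl
    · exact ⟨0, 1, by simp, dvd_rfl, one_dvd _⟩
    · exact ⟨1, 0, by simp, one_dvd _, dvd_rfl⟩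
  by_cases hu : IsUnit p
  · exact ⟨p, 1, by simp, hu.dvd, one_dvd _⟩
  exact h p hp hu r s hrs

/-- In a pre-Schreier domain, a divisor of all `c * a i` splits into a divisor of `c` and a
common divisor of the `a i`. -/
theorem IsPreSchreier.exists_mul_of_forall_dvd_mul {D ι : Type*} [CommRing D] [IsDomain D]
    (h : IsPreSchreier D) (S : Finset ι) (a : ι → D) {d c : D} (hd : ∀ i ∈ S, d ∣ c * a i) :
    ∃ p t : D, d = p * t ∧ p ∣ c ∧ ∀ i ∈ S, t ∣ a i := by
  classical
  induction S using Finset.induction_on with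
  | empty => exact ⟨1, d, by simp, one_dvd _, by simp⟩
  | insert j S _ ih =>
    obtain ⟨p, t, rfl, ⟨c', rfl⟩, ht⟩ := ih fun i hi => hd i (Finset.mem_insert_of_mem hi)
    by_cases hp : p = 0
    · exact ⟨0, 1, by simp [hp], by simp [hp], fun _ _ => one_dvd _⟩
    have hj := hd j (Finset.mem_insert_self j S)
    rw [mul_assoc, mul_dvd_mul_iff_left hp] at hj
    obtain ⟨t₁, t₂, rfl, h₁, h₂⟩ := h.isPrimalElem t _ _ hj
    refine ⟨p * t₁, t₂, (mul_assoc ..).symm, mul_dvd_mul_left p h₁, fun i hi => ?_⟩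
    rcases Finset.mem_insert.mp hi with rfl | hi
    · exact h₂
    · exact (dvd_mul_left t₂ t₁).trans (ht i hi)

/-- Over a pre-Schreier domain every primitive polynomial is superprimitive. -/
theorem IsPrimitivePoly.dvd_of_forall_dvd_mul_coeff {D : Type*} [CommRing D] [IsDomain D]
    (h : IsPreSchreier D) {f : Polynomial D} (hf : IsPrimitivePoly f) {d c : D}
    (hd : ∀ n, d ∣ c * f.coeff n) : d ∣ c := by
  obtain ⟨p, t, rfl, hp, ht⟩ :=
    h.exists_mul_of_forall_dvd_mul f.support f.coeff fun i _ => hd i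
  have hu : IsUnit t := hf t fun n => by
    by_cases hn : n ∈ f.support
    · exact ht n hn
    · rw [Polynomial.notMem_support_iff.mp hn]
      exact dvd_zero t
  exact hu.mul_right_dvd.mpr hp

theorem IsPreSchreier.isGLDomain {D : Type*} [CommRing D] [IsDomain D]
    (h : IsPreSchreier D) : IsGLDomain D := by
  intro f g hf hg d hd
  let φ := Ideal.Quotient.mk (Ideal.span {d})
  have hφ (x : D) : φ x = 0 ↔ d ∣ x := by
    rw [Ideal.Quotient.eq_zero_iff_mem, Ideal.mem_span_singleton]
  have hreg : f.map φ ∈ nonZeroDivisors (Polynomial (D ⧸ Ideal.span {d})) := by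
    by_contra hn
    obtain ⟨a, ha, haf⟩ := Polynomial.notMem_nonZeroDivisors_iff.mp hn
    obtain ⟨c, rfl⟩ := Ideal.Quotient.mk_surjective a
    refine ha ((hφ c).mpr (hf.dvd_of_forall_dvd_mul_coeff h fun n => ?_))
    rw [← hφ, map_mul]
    simpa using congrArg (fun q => q.coeff n) haf
  have hfg : g.map φ * f.map φ = 0 := by
    ext n
    rw [← Polynomial.map_mul, mul_comm g f, Polynomial.coeff_map, Polynomial.coeff_zero, hφ]
    exact hd n
  have hg0 := (mul_right_mem_nonZeroDivisors_eq_zero_iff hreg).mp hfg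
  refine hg d fun n => ?_
  rw [← hφ, ← Polynomial.coeff_map, hg0, Polynomial.coeff_zero]

theorem IsMCDDomain.exists_isRelPrime {D : Type*} [CommRing D] [IsDomain D]
    (h : IsMCDDomain D) {a b : D} (ha : a ≠ 0) (hb : b ≠ 0) :
    ∃ d a' b' : D, a = d * a' ∧ b = d * b' ∧ IsRelPrime a' b' := by
  classical
  obtain ⟨d, hd, hmax⟩ := h {a, b} (by simp) (by simp [ha, hb])
  obtain ⟨a', rfl⟩ := hd a (by simp)
  obtain ⟨b', rfl⟩ := hd b (by simp)
  refine ⟨d, a', b', rfl, rfl, fun e hea heb => ?_⟩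
  have hassoc := hmax (d * e)
    (by simp [mul_dvd_mul_left d hea, mul_dvd_mul_left d heb]) (dvd_mul_right d e)
  refine isUnit_of_dvd_one ((mul_dvd_mul_iff_left (left_ne_zero_of_mul ha)).mp ?_)
  rw [mul_one]
  exact hassoc.symm.dvd

open Polynomial in
theorem IsRelPrime.isPrimitivePoly {D : Type*} [CommRing D] {a b : D} (h : IsRelPrime a b) :
    IsPrimitivePoly (C a * X + C b) := fun d hd =>
  h (by simpa using hd 1) (by simpa using hd 0)

open Polynomial in
/-- In a GL-domain, coprimality to a fixed element is inherited by products. -/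
theorem IsGLDomain.isUnit_of_dvd_mul {D : Type*} [CommRing D] (h : IsGLDomain D) {q r s : D}
    (hr : IsRelPrime q r) (hs : IsRelPrime q s) (hq : q ∣ r * s) : IsUnit q := by
  refine h _ _ hr.isPrimitivePoly hs.isPrimitivePoly q fun n => ?_
  obtain ⟨k, hk⟩ := hq
  have key : (C q * X + C r) * (C q * X + C s) =
      C q * (C q * X ^ 2 + C (r + s) * X + C k) := by
    have : (C r * C s : D[X]) = C q * C k := by rw [← C_mul, hk, C_mul]
    rw [C_add]
    linear_combination this
  rw [key, coeff_C_mul]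
  exact dvd_mul_right _ _

theorem IsGLDomain.isPreSchreier {D : Type*} [CommRing D] [IsDomain D]
    (h : IsGLDomain D) (hMCD : IsMCDDomain D) : IsPreSchreier D := by
  intro p hp _ r s hrs
  by_cases hr : r = 0
  · exact ⟨p, 1, by simp, by simp [hr], one_dvd _⟩
  by_cases hs : s = 0
  · exact ⟨1, p, by simp, one_dvd _, by simp [hs]⟩
  obtain ⟨p₁, p', r', rfl, rfl, hpr⟩ := hMCD.exists_isRelPrime hp hr
  obtain ⟨p₂, q, s', rfl, rfl, hqs⟩ := hMCD.exists_isRelPrime (right_ne_zero_of_mul hp) hs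
  have hp₁ := left_ne_zero_of_mul hp
  have hp₂ := left_ne_zero_of_mul (right_ne_zero_of_mul hp)
  rw [mul_assoc, mul_dvd_mul_iff_left hp₁, mul_left_comm, mul_dvd_mul_iff_left hp₂] at hrs
  have hq := h.isUnit_of_dvd_mul (hpr.of_mul_left_right) hqs hrs
  exact ⟨p₁, p₂ * q, rfl, dvd_mul_right _ _, mul_dvd_mul_left p₂ hq.dvd⟩

theorem stmt3 {D : Type*} [CommRing D] [IsDomain D] (hMCD : IsMCDDomain D) :
    IsPreSchreier D ↔ IsGLDomain D :=
  ⟨fun h => h.isGLDomain, fun h => h.isPreSchreier hMCD⟩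
end

section
/- The monoid algebra R₀ = 𝔽₂[M], where M is the additive commutative monoid ℚ≥0 × ℚ≥0 × ℚ≥0 × (ℕ → ℚ≥0) with componentwise/pointwise addition and ℚ≥0 is the additive monoid of nonnegative rational numbers, is a GCD-domain. -/
/-- The additive monoid `ℚ≥0 × ℚ≥0 × ℚ≥0 × (ℕ → ℚ≥0)` of exponents of the monomials
`X^a Y^b Z^c ∏_i T_i^(t i)`. -/
abbrev ExpMonoid : Type := ℚ≥0 × ℚ≥0 × ℚ≥0 × (ℕ → ℚ≥0)

/-- The monoid algebra `R₀ = 𝔽₂[ExpMonoid]`. -/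
abbrev RZero : Type := AddMonoidAlgebra (ZMod 2) ExpMonoid

/-- Any two elements of `R` have a least common multiple. -/
def HasLcms (R : Type*) [CommRing R] : Prop :=
  ∀ a b : R, ∃ m : R, ∀ u : R, m ∣ u ↔ a ∣ u ∧ b ∣ u

/-- In a domain with least common multiples, nonzero elements have greatest common divisors. -/
theorem HasLcms.exists_gcd {R : Type*} [CommRing R] [IsDomain R] (h : HasLcms R) (a b : R)
    (ha : a ≠ 0) (hb : b ≠ 0) :
    ∃ d : R, d ∣ a ∧ d ∣ b ∧ ∀ d' : R, d' ∣ a → d' ∣ b → d' ∣ d := by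
  obtain ⟨m, hm⟩ := h a b
  obtain ⟨⟨s, hs⟩, ⟨t, ht⟩⟩ := (hm m).1 dvd_rfl
  obtain ⟨d, hd⟩ := (hm (a * b)).2 ⟨dvd_mul_right a b, dvd_mul_left b a⟩
  have hm0 : m ≠ 0 := by
    rintro rfl
    simp [ha, hb] at hd
  refine ⟨d, ⟨t, mul_left_cancel₀ hb ?_⟩, ⟨s, mul_left_cancel₀ ha ?_⟩, ?_⟩
  · linear_combination hd + d * ht
  · linear_combination hd + d * hs
  · rintro d' ⟨a₁, rfl⟩ ⟨b₁, rfl⟩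
    obtain ⟨v, hv⟩ := (hm (d' * a₁ * b₁)).2 ⟨⟨b₁, rfl⟩, ⟨a₁, by ring⟩⟩
    refine ⟨v, mul_left_cancel₀ hm0 ?_⟩
    linear_combination d' * hv - hd

theorem HasLcms.of_uniqueFactorizationMonoid (R : Type*) [CommRing R] [IsDomain R]
    [UniqueFactorizationMonoid R] : HasLcms R := by
  classical
  let := UniqueFactorizationMonoid.toGCDMonoid R
  exact fun a b ↦ ⟨lcm a b, fun u ↦ lcm_dvd_iff⟩

/-- Least common multiples pass to a ring each of whose elements can be moved into the image of
`φ` by multiplying with a unit in the image of `φ`. -/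
theorem HasLcms.of_injective_of_isUnit {R S : Type*} [CommRing R] [CommRing S] (φ : R →+* S)
    (hφ : Function.Injective φ)
    (hclear : ∀ s : S, ∃ e r : R, IsUnit (φ e) ∧ φ e * s = φ r) (h : HasLcms R) : HasLcms S := by
  have key (f u : R) : φ f ∣ φ u ↔ ∃ e, IsUnit (φ e) ∧ f ∣ e * u := by
    constructor
    · rintro ⟨s, hs⟩
      obtain ⟨e, r, he, hr⟩ := hclear s
      refine ⟨e, he, r, hφ ?_⟩
      rw [map_mul, map_mul, hs, ← hr]
      ring
    · rintro ⟨e, he, hd⟩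
      have := map_dvd φ hd
      rwa [map_mul, he.dvd_mul_left] at this
  intro a b
  obtain ⟨e, a', he, ha⟩ := hclear a
  obtain ⟨e', b', he', hb⟩ := hclear b
  obtain ⟨m, hm⟩ := h a' b'
  refine ⟨φ m, fun u ↦ ?_⟩
  obtain ⟨e'', u', he'', hu⟩ := hclear u
  rw [← he.mul_left_dvd (a := a), ← he'.mul_left_dvd (a := b), ← he''.dvd_mul_left (a := φ m),
    ← he''.dvd_mul_left (a := φ e * a), ← he''.dvd_mul_left (a := φ e' * b), ha, hb, hu]
  constructor
  · intro hd
    exact ⟨(map_dvd φ ((hm m).1 dvd_rfl).1).trans hd, (map_dvd φ ((hm m).1 dvd_rfl).2).trans hd⟩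
  · rintro ⟨h₁, h₂⟩
    obtain ⟨c, hc, hd⟩ := (key _ _).1 h₁
    obtain ⟨c', hc', hd'⟩ := (key _ _).1 h₂
    refine (key _ _).2 ⟨c * c', by simpa using hc.mul hc', (hm _).2 ⟨?_, ?_⟩⟩
    · rw [mul_right_comm]
      exact hd.mul_right _
    · rw [mul_assoc]
      exact hd'.mul_left _

theorem HasLcms.of_ringEquiv {R S : Type*} [CommRing R] [CommRing S] (e : R ≃+* S)
    (h : HasLcms R) : HasLcms S :=
  h.of_injective_of_isUnit (e : R →+* S) e.injective fun s ↦ ⟨1, e.symm s, by simp, by simp⟩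

namespace AddMonoidAlgebra

variable {K : Type*} [Field K]

theorem isUnit_single_one {G : Type*} [AddCommGroup G] (g : G) :
    IsUnit (single g (1 : K)) :=
  IsUnit.of_mul_eq_one (single (-g) 1) (by simp [single_mul_single, one_def])

theorem hasLcms_of_monoidHom {N G : Type*} [AddCommMonoid N] [AddCommGroup G] (j : N →+ G)
    (hj : Function.Injective j) (hclear : ∀ x : G, ∃ n n' : N, j n + x = j n')
    (h : HasLcms (AddMonoidAlgebra K N)) : HasLcms (AddMonoidAlgebra K G) := by
  refine h.of_injective_of_isUnit (mapDomainRingHom K j) (mapDomain_injective hj) fun s ↦ ?_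
  induction s using induction_linear with
  | zero => exact ⟨1, 0, by simp, by simp⟩
  | add f g hf hg =>
    obtain ⟨e, r, he, hr⟩ := hf
    obtain ⟨e', r', he', hr'⟩ := hg
    refine ⟨e * e', e' * r + e * r', by rw [map_mul]; exact he.mul he', ?_⟩
    rw [map_add, map_mul, map_mul, map_mul, ← hr, ← hr']
    ring
  | single x r =>
    obtain ⟨n, n', hn⟩ := hclear x
    refine ⟨single n 1, single n' r, ?_, ?_⟩
    · simpa using isUnit_single_one (K := K) (j n)
    · simp [single_mul_single, hn]

/-- Laurent polynomials in finitely many variables over a field have least common multiples. -/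
theorem hasLcms_finsupp_int (σ : Type*) : HasLcms (AddMonoidAlgebra K (σ →₀ ℤ)) := by
  refine hasLcms_of_monoidHom (Finsupp.mapRange.addMonoidHom (Nat.castAddMonoidHom ℤ))
    (Finsupp.mapRange_injective _ (by simp) Nat.cast_injective) (fun x ↦ ?_)
    (HasLcms.of_uniqueFactorizationMonoid (MvPolynomial σ K))
  refine ⟨x.mapRange (fun z ↦ (-z).toNat) (by simp), x.mapRange Int.toNat (by simp), ?_⟩
  ext i
  simp
  omega

theorem hasLcms_of_fg {H : Type*} [AddCommGroup H] [IsAddTorsionFree H] [Module.Finite ℤ H] :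
    HasLcms (AddMonoidAlgebra K H) := by
  obtain ⟨n, b⟩ := Module.basisOfFiniteTypeTorsionFree' (R := ℤ) (M := H)
  exact (hasLcms_finsupp_int (Fin n)).of_ringEquiv
    (mapDomainRingEquiv K b.repr.symm.toAddEquiv)

section Subgroup

variable {G : Type*} [AddCommGroup G] (H : AddSubgroup G)

/-- The part of `u` supported on the coset `H + g`, translated back to `H`. -/
noncomputable def cosetPart (g : G) : AddMonoidAlgebra K G →+ AddMonoidAlgebra K H :=
  comapDomainAddMonoidHom (fun h : H ↦ (h : G) + g)
    ((add_left_injective g).comp Subtype.val_injective)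

theorem coeff_cosetPart (g : G) (u : AddMonoidAlgebra K G) (h : H) :
    (cosetPart H g u).coeff h = u.coeff (h + g) := by
  simp [cosetPart]

theorem cosetPart_mapDomain_mul (g : G) (f : AddMonoidAlgebra K H) (u : AddMonoidAlgebra K G) :
    cosetPart H g (mapDomainRingHom K H.subtype f * u) = f * cosetPart H g u := by
  induction f using induction_linear with
  | zero => simp
  | add f₁ f₂ h₁ h₂ => rw [map_add, add_mul, map_add, h₁, h₂, add_mul]
  | single h r =>
    ext x
    rw [coeff_cosetPart, coeff_single_mul_eq_mul_coeff (-h + x), coeff_cosetPart]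
    · simp only [mapDomainRingHom_apply, mapDomain_single]
      rw [coeff_single_mul_eq_mul_coeff (-(h : G) + x + g)]
      · simp
      · intro m _
        simp only [AddSubgroup.coe_subtype]
        constructor
        · intro h'
          rw [add_assoc, ← h']
          abel
        · rintro rfl
          abel
    · intro m _
      constructor
      · rintro rfl
        abel
      · rintro rfl
        abel

theorem coeff_mapDomain_cosetPart_mul_single (g : G) (u : AddMonoidAlgebra K G) (x : G)
    [Decidable (x - g ∈ H)] :
    (mapDomainRingHom K H.subtype (cosetPart H g u) * single g 1).coeff x =
      if x - g ∈ H then u.coeff x else 0 := by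
  rw [coeff_mul_single_eq_coeff_mul (x - g) (fun _ _ ↦ eq_sub_iff_add_eq.symm), mul_one,
    mapDomainRingHom_apply]
  change Finsupp.mapDomain H.subtype (cosetPart H g u).coeff (x - g) = _
  split_ifs with hx
  · have := Finsupp.mapDomain_apply H.subtype_injective (cosetPart H g u).coeff ⟨x - g, hx⟩
    rw [AddSubgroup.subtype_apply] at this
    rw [this, coeff_cosetPart]
    simp
  · exact Finsupp.mapDomain_of_notMem_range _ _ (by simpa using hx)

/-- Divisibility by an element of `K[H]` can be tested on each coset of `H`. -/
theorem mapDomain_dvd_iff_forall_dvd_cosetPart (f : AddMonoidAlgebra K H)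
    (u : AddMonoidAlgebra K G) :
    mapDomainRingHom K H.subtype f ∣ u ↔ ∀ g, f ∣ cosetPart H g u := by
  classical
  constructor
  · rintro ⟨q, rfl⟩ g
    rw [cosetPart_mapDomain_mul]
    exact dvd_mul_right _ _
  · intro hu
    induction hn : u.coeff.support.card using Nat.strong_induction_on generalizing u with
    | _ n ih =>
      subst hn
      by_cases hu0 : u = 0
      · simp [hu0]
      obtain ⟨g, hg⟩ := Finsupp.support_nonempty_iff.2 (coeff_eq_zero.not.2 hu0)
      set w := mapDomainRingHom K H.subtype (cosetPart H g u) * single g 1 with hw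
      have hcoeff (x : G) : (u - w).coeff x = if x - g ∈ H then 0 else u.coeff x := by
        change u.coeff x - w.coeff x = _
        rw [hw, coeff_mapDomain_cosetPart_mul_single]
        split_ifs <;> simp
      have hdvd : mapDomainRingHom K H.subtype f ∣ w := (map_dvd _ (hu g)).mul_right _
      refine (dvd_sub_left hdvd).1 (ih _ (Finset.card_lt_card ?_) (u - w) ?_ rfl)
      · refine (Finset.ssubset_iff_of_subset fun x hx ↦ ?_).2 ⟨g, hg, ?_⟩
        · rw [Finsupp.mem_support_iff, hcoeff] at hx
          rw [Finsupp.mem_support_iff]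
          split_ifs at hx
          · exact absurd rfl hx
          · exact hx
        · rw [Finsupp.notMem_support_iff, hcoeff]
          simp
      · intro g'
        rw [map_sub, hw, cosetPart_mapDomain_mul]
        exact dvd_sub (hu g') ((hu g).mul_right _)

/-- The group algebra of a torsion-free abelian group over a field has least common multiples. -/
theorem hasLcms_of_isAddTorsionFree [IsAddTorsionFree G] : HasLcms (AddMonoidAlgebra K G) := by
  classical
  intro a b
  let T : Finset G := a.coeff.support ∪ b.coeff.support
  let H : AddSubgroup G := AddSubgroup.closure (T : Set G)
  have hH : H.FG := ⟨T, rfl⟩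
  have : Module.Finite ℤ H := by
    rw [Module.Finite.iff_addGroup_fg]
    exact (AddGroup.fg_iff_addSubgroup_fg H).2 hH
  have hmem (c : AddMonoidAlgebra K G) (hc : c.coeff.support ⊆ T) :
      ∃ c' : AddMonoidAlgebra K H, mapDomainRingHom K H.subtype c' = c :=
    ⟨_, mapDomain_comapDomain (fun x hx ↦ ⟨⟨x, AddSubgroup.subset_closure (hc hx)⟩, rfl⟩)
      H.subtype_injective⟩
  obtain ⟨a', ha⟩ := hmem a Finset.subset_union_left
  obtain ⟨b', hb⟩ := hmem b Finset.subset_union_right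
  obtain ⟨m, hm⟩ := hasLcms_of_fg (K := K) (H := H) a' b'
  refine ⟨mapDomainRingHom K H.subtype m, fun u ↦ ?_⟩
  rw [← ha, ← hb]
  simp only [mapDomain_dvd_iff_forall_dvd_cosetPart, hm, forall_and]

end Subgroup

section Content

variable {ι : Type*}

/-- `c` is the coordinatewise minimum of the exponents of `f`. -/
def IsContent (f : AddMonoidAlgebra K (ι → ℚ)) (c : ι → ℚ) : Prop :=
  ∀ i, IsLeast ((fun x : ι → ℚ ↦ x i) '' (f.coeff.support : Set (ι → ℚ))) (c i)

theorem exists_isContent {f : AddMonoidAlgebra K (ι → ℚ)} (hf : f ≠ 0) :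
    ∃ c, IsContent f c := by
  have hne : f.coeff.support.Nonempty := Finsupp.support_nonempty_iff.2 (coeff_eq_zero.not.2 hf)
  have (i : ι) : ∃ q, IsLeast ((fun x : ι → ℚ ↦ x i) '' (f.coeff.support : Set (ι → ℚ))) q := by
    obtain ⟨x, hx, hmin⟩ := f.coeff.support.exists_min_image (fun x ↦ x i) hne
    refine ⟨x i, ⟨x, hx, rfl⟩, ?_⟩
    rintro _ ⟨y, hy, rfl⟩
    exact hmin y hy
  choose c hc using this
  exact ⟨c, hc⟩

theorem IsContent.unique {f : AddMonoidAlgebra K (ι → ℚ)} {c d : ι → ℚ} (hc : IsContent f c)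
    (hd : IsContent f d) : c = d :=
  funext fun i ↦ (hc i).unique (hd i)

theorem isContent_single (c : ι → ℚ) : IsContent (single c (1 : K)) c := by
  intro i
  rw [coeff_single, Finsupp.support_single _ one_ne_zero]
  simp

/-- Gauss's lemma: the content is multiplicative. -/
theorem IsContent.mul {f g : AddMonoidAlgebra K (ι → ℚ)} {c d : ι → ℚ} (hf : IsContent f c)
    (hg : IsContent g d) : IsContent (f * g) (c + d) := by
  classical
  intro i
  have lef (x) (hx : x ∈ f.coeff.support) : c i ≤ x i := (hf i).2 ⟨x, hx, rfl⟩
  have leg (y) (hy : y ∈ g.coeff.support) : d i ≤ y i := (hg i).2 ⟨y, hy, rfl⟩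
  constructor
  · obtain ⟨x₀, hx₀, hxi⟩ := (hf i).1
    obtain ⟨y₀, hy₀, hyi⟩ := (hg i).1
    obtain ⟨x, hx, y, hy, huniq⟩ := UniqueSums.uniqueAdd_of_nonempty
      (A := f.coeff.support.filter (fun x ↦ x i = c i))
      (B := g.coeff.support.filter (fun y ↦ y i = d i))
      ⟨x₀, Finset.mem_filter.2 ⟨hx₀, hxi⟩⟩ ⟨y₀, Finset.mem_filter.2 ⟨hy₀, hyi⟩⟩
    rw [Finset.mem_filter] at hx hy
    have huniq' : UniqueAdd f.coeff.support g.coeff.support x y := by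
      intro x' y' hx' hy' h
      have hi : x' i + y' i = c i + d i := by
        rw [← hx.2, ← hy.2]
        exact congrFun h i
      have h₁ := lef x' hx'
      have h₂ := leg y' hy'
      exact huniq (Finset.mem_filter.2 ⟨hx', by linarith⟩)
        (Finset.mem_filter.2 ⟨hy', by linarith⟩) h
    refine ⟨x + y, ?_, by simp [hx.2, hy.2]⟩
    rw [Finset.mem_coe, Finsupp.mem_support_iff, coeff_mul_add_of_uniqueAdd huniq']
    exact mul_ne_zero (Finsupp.mem_support_iff.1 hx.1) (Finsupp.mem_support_iff.1 hy.1)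
  · rintro _ ⟨z, hz, rfl⟩
    obtain ⟨x, hx, y, hy, rfl⟩ := Finset.mem_add.1 (support_coeff_mul_subset f g hz)
    exact add_le_add (lef x hx) (leg y hy)

/-- The inclusion of `ι → ℚ≥0` into `ι → ℚ`. -/
def nnratPiCast (ι : Type*) : (ι → ℚ≥0) →+ (ι → ℚ) where
  toFun x i := x i
  map_zero' := by ext; simp
  map_add' x y := by ext; simp

theorem nnratPiCast_injective : Function.Injective (nnratPiCast ι) := fun _ _ h ↦
  funext fun i ↦ NNRat.coe_injective (congrFun h i)

theorem IsContent.nonneg_iff {f : AddMonoidAlgebra K (ι → ℚ)} {c : ι → ℚ} (hf : IsContent f c) :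
    0 ≤ c ↔ ∃ f', mapDomainRingHom K (nnratPiCast ι) f' = f := by
  classical
  constructor
  · intro hc
    refine ⟨_, mapDomain_comapDomain (fun x hx ↦ ?_) nnratPiCast_injective⟩
    have hx0 (i : ι) : 0 ≤ x i := (hc i).trans ((hf i).2 ⟨x, hx, rfl⟩)
    exact ⟨fun i ↦ ⟨x i, hx0 i⟩, rfl⟩
  · rintro ⟨f', rfl⟩ i
    obtain ⟨x, hx, hxi⟩ := (hf i).1
    obtain ⟨y, -, rfl⟩ := Finset.mem_image.1 (Finsupp.mapDomain_support hx)
    rw [← hxi]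
    exact (y i).2

/-- The monoid algebra of `ι → ℚ≥0` over a field has least common multiples. -/
theorem hasLcms_nnratPi (ι : Type*) : HasLcms (AddMonoidAlgebra K (ι → ℚ≥0)) := by
  set φ := mapDomainRingHom K (nnratPiCast ι) with hφ_def
  have hφ : Function.Injective φ := mapDomain_injective nnratPiCast_injective
  have hφ0 (f) : φ f = 0 ↔ f = 0 := map_eq_zero_iff φ hφ
  have dvd_of_le {a u : AddMonoidAlgebra K (ι → ℚ≥0)} {c d : ι → ℚ} (hu : u ≠ 0)
      (hc : IsContent (φ a) c) (hd : IsContent (φ u) d) (hcd : c ≤ d) (h : φ a ∣ φ u) :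
      a ∣ u := by
    obtain ⟨q, hq⟩ := h
    have hq0 : q ≠ 0 := by
      rintro rfl
      rw [mul_zero, hφ0] at hq
      exact hu hq
    obtain ⟨e, he⟩ := exists_isContent hq0
    have hde : d = c + e := hd.unique (hq ▸ hc.mul he)
    obtain ⟨q', rfl⟩ := he.nonneg_iff.1 (le_add_iff_nonneg_right c |>.1 (hde ▸ hcd))
    exact ⟨q', hφ (by rw [hq, map_mul])⟩
  have le_of_dvd {a u : AddMonoidAlgebra K (ι → ℚ≥0)} {c d : ι → ℚ} (hu : u ≠ 0)
      (hc : IsContent (φ a) c) (hd : IsContent (φ u) d) (h : a ∣ u) : c ≤ d := by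
    obtain ⟨q, rfl⟩ := h
    obtain ⟨e, he⟩ := exists_isContent ((hφ0 q).not.2 (right_ne_zero_of_mul hu))
    rw [map_mul] at hd
    rw [hd.unique (hc.mul he)]
    exact le_add_of_nonneg_right (he.nonneg_iff.2 ⟨q, rfl⟩)
  intro a b
  by_cases ha : a = 0
  · subst ha
    exact ⟨0, fun u ↦ ⟨fun h ↦ ⟨h, (dvd_zero b).trans h⟩, And.left⟩⟩
  by_cases hb : b = 0
  · subst hb
    exact ⟨0, fun u ↦ ⟨fun h ↦ ⟨(dvd_zero a).trans h, h⟩, And.right⟩⟩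
  obtain ⟨c, hc⟩ := exists_isContent ((hφ0 a).not.2 ha)
  obtain ⟨d, hd⟩ := exists_isContent ((hφ0 b).not.2 hb)
  obtain ⟨m, hm⟩ := hasLcms_of_isAddTorsionFree (φ a) (φ b)
  have hm0 : m ≠ 0 := by
    rintro rfl
    have := (hm (φ a * φ b)).2 ⟨dvd_mul_right _ _, dvd_mul_left _ _⟩
    rw [zero_dvd_iff, mul_eq_zero, hφ0, hφ0] at this
    exact this.elim ha hb
  obtain ⟨e, he⟩ := exists_isContent hm0
  have hM : IsContent (single (c ⊔ d - e) (1 : K) * m) (c ⊔ d) := by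
    simpa using (isContent_single (K := K) (c ⊔ d - e)).mul he
  have hM0 : single (c ⊔ d - e) (1 : K) * m ≠ 0 :=
    mul_ne_zero (isUnit_single_one _).ne_zero hm0
  have hMdvd (u) : single (c ⊔ d - e) (1 : K) * m ∣ u ↔ φ a ∣ u ∧ φ b ∣ u := by
    rw [(isUnit_single_one _).mul_left_dvd, hm]
  obtain ⟨m', hm'⟩ := hM.nonneg_iff.1 ((hc.nonneg_iff.2 ⟨a, rfl⟩).trans le_sup_left)
  rw [← hφ_def] at hm'
  rw [← hm'] at hM hM0 hMdvd
  have hm'0 : m' ≠ 0 := (hφ0 m').not.1 hM0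
  have ham : a ∣ m' := dvd_of_le hm'0 hc hM le_sup_left ((hMdvd _).1 dvd_rfl).1
  have hbm : b ∣ m' := dvd_of_le hm'0 hd hM le_sup_right ((hMdvd _).1 dvd_rfl).2
  refine ⟨m', fun u ↦ ⟨fun h ↦ ⟨ham.trans h, hbm.trans h⟩, fun ⟨hau, hbu⟩ ↦ ?_⟩⟩
  by_cases hu : u = 0
  · simp [hu]
  obtain ⟨t, ht⟩ := exists_isContent ((hφ0 u).not.2 hu)
  exact dvd_of_le hu hM ht (sup_le (le_of_dvd hu hc ht hau) (le_of_dvd hu hd ht hbu))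
    ((hMdvd _).2 ⟨map_dvd φ hau, map_dvd φ hbu⟩)

end Content

end AddMonoidAlgebra

/-- The exponent monoid as a monoid of functions. -/
def ExpMonoid.equivPi : (Unit ⊕ Unit ⊕ Unit ⊕ ℕ → ℚ≥0) ≃+ ExpMonoid where
  toFun x := (x (.inl ()), x (.inr (.inl ())), x (.inr (.inr (.inl ()))),
    fun n ↦ x (.inr (.inr (.inr n))))
  invFun y := Sum.elim (fun _ ↦ y.1) (Sum.elim (fun _ ↦ y.2.1)
    (Sum.elim (fun _ ↦ y.2.2.1) y.2.2.2))
  left_inv x := by ext (_ | _ | _ | _) <;> rfl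
  right_inv y := rfl
  map_add' x y := rfl

/-- `R₀` is a GCD-domain: it is an integral domain and every pair of nonzero
elements has a greatest common divisor. -/
theorem stmt10 :
    IsDomain RZero ∧
      ∀ a b : RZero, a ≠ 0 → b ≠ 0 →
        ∃ d : RZero, d ∣ a ∧ d ∣ b ∧ ∀ d' : RZero, d' ∣ a → d' ∣ b → d' ∣ d := by
  have e : AddMonoidAlgebra (ZMod 2) (Unit ⊕ Unit ⊕ Unit ⊕ ℕ → ℚ≥0) ≃+* RZero :=
    AddMonoidAlgebra.mapDomainRingEquiv (ZMod 2) ExpMonoid.equivPi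
  have hdom : IsDomain RZero := e.symm.toMulEquiv.isDomain _
  exact ⟨hdom, ((AddMonoidAlgebra.hasLcms_nnratPi _).of_ringEquiv e).exists_gcd⟩
end

section
/- Let R₀ = 𝔽₂[M] where M = ℚ≥0 × ℚ≥0 × ℚ≥0 × (ℕ → ℚ≥0), and let R be the 𝔽₂-subalgebra of R₀ generated by the monomials X^α, Y^α, Z^α for α ∈ ℚ≥0 together with all monomials X^α ∏_i T_i^{t(i)}, Y^α ∏_i T_i^{t(i)}, Z^α ∏_i T_i^{t(i)} with α ∈ ℚ, α > 0, and t : ℕ → ℚ≥0. If f, g ∈ R₀ are such that the product fg lies in R, then f ∈ R or g ∈ R. -/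
/-- The generating monomials of `R`: the monomials `X^α`, `Y^α`, `Z^α` for `α ∈ ℚ≥0`,
together with the monomials `X^α ∏_i T_i^(t i)`, `Y^α ∏_i T_i^(t i)`, `Z^α ∏_i T_i^(t i)`
for a positive rational `α` and `t : ℕ → ℚ≥0`. -/
def GenSet : Set RZero :=
  { x | (∃ α : ℚ≥0, x = AddMonoidAlgebra.single (α, 0, 0, 0) 1)
      ∨ (∃ α : ℚ≥0, x = AddMonoidAlgebra.single (0, α, 0, 0) 1)
      ∨ (∃ α : ℚ≥0, x = AddMonoidAlgebra.single (0, 0, α, 0) 1)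
      ∨ (∃ (α : ℚ≥0) (t : ℕ → ℚ≥0), 0 < α ∧ x = AddMonoidAlgebra.single (α, 0, 0, t) 1)
      ∨ (∃ (α : ℚ≥0) (t : ℕ → ℚ≥0), 0 < α ∧ x = AddMonoidAlgebra.single (0, α, 0, t) 1)
      ∨ (∃ (α : ℚ≥0) (t : ℕ → ℚ≥0), 0 < α ∧ x = AddMonoidAlgebra.single (0, 0, α, t) 1) }

/-- The subalgebra `R` of `R₀` generated by `GenSet`. -/
noncomputable def RSub : Subalgebra (ZMod 2) RZero := Algebra.adjoin (ZMod 2) GenSet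

/-- The exponents of the monomials lying in `R`. -/
def ringExponents : AddSubmonoid ExpMonoid where
  carrier := { m | m.1 = 0 → m.2.1 = 0 → m.2.2.1 = 0 → m.2.2.2 = 0 }
  zero_mem' _ _ _ := rfl
  add_mem' {m n} hm hn ha hb hc := by
    obtain ⟨ha₁, ha₂⟩ := add_eq_zero.mp ha
    obtain ⟨hb₁, hb₂⟩ := add_eq_zero.mp hb
    obtain ⟨hc₁, hc₂⟩ := add_eq_zero.mp hc
    exact add_eq_zero.mpr ⟨hm ha₁ hb₁ hc₁, hn ha₂ hb₂ hc₂⟩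

/-- The elements of a monoid algebra supported in a submonoid form a subalgebra. -/
def AddSubmonoid.supportedSubalgebra (k : Type*) {M : Type*} [CommSemiring k] [AddMonoid M]
    (S : AddSubmonoid M) : Subalgebra k (AddMonoidAlgebra k M) where
  carrier := { f | ∀ m ∈ f.coeff.support, m ∈ S }
  mul_mem' {f g} hf hg m hm := by
    classical
    obtain ⟨a, ha, b, hb, rfl⟩ := Finset.mem_add.mp (AddMonoidAlgebra.support_coeff_mul_subset _ _ hm)
    exact S.add_mem (hf a ha) (hg b hb)
  add_mem' {f g} hf hg m hm := by
    classical
    rcases Finset.mem_union.mp (Finsupp.support_add hm) with h | h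
    exacts [hf m h, hg m h]
  algebraMap_mem' r m hm := by
    have : m = 0 := by
      by_contra h
      simp [AddMonoidAlgebra.coe_algebraMap, h] at hm
    exact this ▸ S.zero_mem

theorem AddSubmonoid.mem_supportedSubalgebra {k M : Type*} [CommSemiring k] [AddMonoid M]
    {S : AddSubmonoid M} {f : AddMonoidAlgebra k M} :
    f ∈ S.supportedSubalgebra k ↔ ∀ m ∈ f.coeff.support, m ∈ S :=
  Iff.rfl

theorem single_mem_RSub {m : ExpMonoid} (hm : m ∈ ringExponents) :
    (AddMonoidAlgebra.single m 1 : RZero) ∈ RSub := by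
  obtain ⟨a, b, c, t⟩ := m
  have key : ∀ {p q r : ExpMonoid}, AddMonoidAlgebra.single p 1 ∈ GenSet →
      AddMonoidAlgebra.single q 1 ∈ GenSet → AddMonoidAlgebra.single r 1 ∈ GenSet →
      p + q + r = (a, b, c, t) → (AddMonoidAlgebra.single (a, b, c, t) 1 : RZero) ∈ RSub := by
    intro p q r hp hq hr h
    have := mul_mem (mul_mem (Algebra.subset_adjoin (R := ZMod 2) hp)
      (Algebra.subset_adjoin hq)) (Algebra.subset_adjoin hr)
    rwa [AddMonoidAlgebra.single_mul_single, AddMonoidAlgebra.single_mul_single, h, mul_one,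
      mul_one] at this
  have hX (α : ℚ≥0) : AddMonoidAlgebra.single (α, 0, 0, 0) 1 ∈ GenSet := .inl ⟨α, rfl⟩
  have hY (α : ℚ≥0) : AddMonoidAlgebra.single (0, α, 0, 0) 1 ∈ GenSet := .inr (.inl ⟨α, rfl⟩)
  have hZ (α : ℚ≥0) : AddMonoidAlgebra.single (0, 0, α, 0) 1 ∈ GenSet :=
    .inr (.inr (.inl ⟨α, rfl⟩))
  rcases eq_or_ne a 0 with ha | ha
  · rcases eq_or_ne b 0 with hb | hb
    · rcases eq_or_ne c 0 with hc | hc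
      · exact key (hX a) (hY b) (hZ c) (by simp [show t = 0 from hm ha hb hc])
      · exact key (hX a) (hY b)
          (.inr (.inr (.inr (.inr (.inr ⟨c, t, pos_iff_ne_zero.mpr hc, rfl⟩))))) (by simp)
    · exact key (hX a) (.inr (.inr (.inr (.inr (.inl ⟨b, t, pos_iff_ne_zero.mpr hb, rfl⟩)))))
        (hZ c) (by simp)
  · exact key (.inr (.inr (.inr (.inl ⟨a, t, pos_iff_ne_zero.mpr ha, rfl⟩)))) (hY b) (hZ c)
      (by simp)

theorem RSub_eq_supportedSubalgebra : RSub = ringExponents.supportedSubalgebra (ZMod 2) := by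
  apply le_antisymm
  · refine Algebra.adjoin_le ?_
    have key : ∀ {p : ExpMonoid}, p ∈ ringExponents →
        (AddMonoidAlgebra.single p 1 : RZero) ∈ ringExponents.supportedSubalgebra (ZMod 2) := by
      intro p hp m hm
      have : m = p := by
        simpa using hm
      exact this ▸ hp
    rintro x (⟨α, rfl⟩ | ⟨α, rfl⟩ | ⟨α, rfl⟩ | ⟨α, t, hα, rfl⟩ | ⟨α, t, hα, rfl⟩ |
      ⟨α, t, hα, rfl⟩)
    · exact key fun _ _ _ ↦ rfl
    · exact key fun _ _ _ ↦ rfl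
    · exact key fun _ _ _ ↦ rfl
    · exact key fun h _ _ ↦ absurd h hα.ne'
    · exact key fun _ h _ ↦ absurd h hα.ne'
    · exact key fun _ _ h ↦ absurd h hα.ne'
  · intro f hf
    rw [← AddMonoidAlgebra.sum_coeff_single f]
    refine sum_mem fun m hm ↦ ?_
    simpa [AddMonoidAlgebra.smul_single] using
      RSub.smul_mem (single_mem_RSub (hf m hm)) (f.coeff m)

/-- Two finite subsets of a `TwoUniqueSums` monoid, both nonempty and the first with a nonzero
element, have a nonzero sum attained by exactly one pair, provided `0` is the only unit. -/
theorem exists_uniqueAdd_add_ne_zero {M : Type*} [AddCommMonoid M] [TwoUniqueSums M]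
    [Subsingleton (AddUnits M)] {A B : Finset M} {a b : M} (ha : a ∈ A) (hb : b ∈ B) (ha₀ : a ≠ 0) :
    ∃ p ∈ A, ∃ q ∈ B, UniqueAdd A B p q ∧ p + q ≠ 0 := by
  by_cases hcard : 1 < A.card * B.card
  · obtain ⟨p, hp, q, hq, hpq, hup, huq⟩ := TwoUniqueSums.uniqueAdd_of_one_lt_card hcard
    rw [Finset.mem_product] at hp hq
    by_cases h : p.1 + p.2 = 0
    · refine ⟨q.1, hq.1, q.2, hq.2, huq, fun h' ↦ hpq ?_⟩
      have := huq hp.1 hp.2 (h.trans h'.symm)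
      exact Prod.ext this.1 this.2
    · exact ⟨p.1, hp.1, p.2, hp.2, hup, h⟩
  · have hA : 0 < A.card := Finset.card_pos.mpr ⟨a, ha⟩
    have hB : 0 < B.card := Finset.card_pos.mpr ⟨b, hb⟩
    have hA₁ : A.card ≤ 1 := by nlinarith
    have hB₁ : B.card ≤ 1 := by nlinarith
    rw [Finset.card_le_one] at hA₁ hB₁
    refine ⟨a, ha, b, hb, fun x y hx hy _ ↦ ⟨hA₁ x hx a ha, hB₁ y hy b hb⟩, fun h ↦ ha₀ ?_⟩
    exact (add_eq_zero.mp h).1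

instance : TwoUniqueSums ExpMonoid :=
  have : TwoUniqueSums (ℚ≥0 × (ℕ → ℚ≥0)) := inferInstance
  have : TwoUniqueSums (ℚ≥0 × ℚ≥0 × (ℕ → ℚ≥0)) := Prod.instTwoUniqueSums
  Prod.instTwoUniqueSums

theorem stmt11 (f g : RZero) (h : f * g ∈ RSub) : f ∈ RSub ∨ g ∈ RSub := by
  classical
  rw [RSub_eq_supportedSubalgebra] at h ⊢
  by_contra! hfg
  simp only [AddSubmonoid.mem_supportedSubalgebra, not_forall] at hfg
  obtain ⟨⟨a, haf, ha⟩, b, hbg, hb⟩ := hfg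
  let V : ExpMonoid → Prop := fun m ↦ m.1 = 0 ∧ m.2.1 = 0 ∧ m.2.2.1 = 0
  have V_add {x y : ExpMonoid} : V (x + y) ↔ V x ∧ V y := by
    simp only [V, Prod.fst_add, Prod.snd_add, add_eq_zero]
    tauto
  have V_of_not_mem {m : ExpMonoid} (hm : m ∉ ringExponents) : V m :=
    ⟨by_contra fun h ↦ hm fun h' ↦ absurd h' h, by_contra fun h ↦ hm fun _ h' ↦ absurd h' h,
      by_contra fun h ↦ hm fun _ _ h' ↦ absurd h' h⟩
  obtain ⟨p, hp, q, hq, hu, hpq⟩ := exists_uniqueAdd_add_ne_zero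
    (Finset.mem_filter.mpr ⟨haf, V_of_not_mem ha⟩) (Finset.mem_filter.mpr ⟨hbg, V_of_not_mem hb⟩)
    fun h₀ ↦ ha (h₀ ▸ ringExponents.zero_mem)
  rw [Finset.mem_filter] at hp hq
  have hV : V (p + q) := V_add.mpr ⟨hp.2, hq.2⟩
  have hu' : UniqueAdd f.coeff.support g.coeff.support p q := by
    intro x y hx hy hxy
    obtain ⟨hVx, hVy⟩ := V_add.mp (hxy ▸ hV)
    exact hu (Finset.mem_filter.mpr ⟨hx, hVx⟩) (Finset.mem_filter.mpr ⟨hy, hVy⟩) hxy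
  have hmem : p + q ∈ (f * g).coeff.support := by
    rw [Finsupp.mem_support_iff, AddMonoidAlgebra.coeff_mul_add_of_uniqueAdd hu']
    exact mul_ne_zero (Finsupp.mem_support_iff.mp hp.1) (Finsupp.mem_support_iff.mp hq.1)
  exact hpq (Prod.ext hV.1 (Prod.ext hV.2.1 (Prod.ext hV.2.2 (h _ hmem hV.1 hV.2.1 hV.2.2))))
end

section
/- Let R₀ = 𝔽₂[M] where M = ℚ≥0 × ℚ≥0 × ℚ≥0 × (ℕ → ℚ≥0), and let R be the 𝔽₂-subalgebra of R₀ generated by the monomials X^α, Y^α, Z^α for α ∈ ℚ≥0 together with all monomials X^α ∏_i T_i^{t(i)}, Y^α ∏_i T_i^{t(i)}, Z^α ∏_i T_i^{t(i)} with α ∈ ℚ, α > 0, and t : ℕ → ℚ≥0. Set s_y = XY∏_{i∈ℕ}T_i (the monomial with exponents (1,1,0) on X,Y,Z and t(i) = 1 for all i) and s_z = XZ∏_{i∈ℕ}T_i (exponents (1,0,1) and t(i) = 1 for all i), and for each i ∈ ℕ set b_i = X∏_{j≠i}T_j (exponents (1,0,0) and t(j) = 1 for j ≠ i, t(i) = 0).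 Then for every i ∈ ℕ, b_i is a maximal common divisor in R of the pair {s_y, s_z}, and for i ≠ j the elements b_i and b_j are not associates in R. -/
namespace AddMonoidAlgebra

/-- Over a ring without zero divisors and a monoid with the two unique sums property, the divisors
of a nonzero monomial are monomials. -/
lemma exists_single_of_mul_eq_single {R A : Type*} [Semiring R] [NoZeroDivisors R] [Add A]
    [TwoUniqueSums A] {f g : AddMonoidAlgebra R A} {m : A} {r : R} (hr : r ≠ 0)
    (h : f * g = single m r) :
    ∃ p q a b, f = single p a ∧ g = single q b ∧ p + q = m ∧ a * b = r := by
  classical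
  have hne : f * g ≠ 0 := by simpa [h] using hr
  have hf : f.coeff.support.Nonempty := by
    rw [Finsupp.support_nonempty_iff]
    exact fun h0 ↦ hne (by rw [show f = 0 from coeff_injective h0, zero_mul])
  have hg : g.coeff.support.Nonempty := by
    rw [Finsupp.support_nonempty_iff]
    exact fun h0 ↦ hne (by rw [show g = 0 from coeff_injective h0, mul_zero])
  have sum_eq : ∀ p : A × A, p ∈ f.coeff.support ×ˢ g.coeff.support →
      UniqueAdd f.coeff.support g.coeff.support p.1 p.2 → p.1 + p.2 = m := by
    intro p hp hu
    have hc := coeff_mul_add_of_uniqueAdd hu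
    rw [h] at hc
    rw [Finset.mem_product, Finsupp.mem_support_iff, Finsupp.mem_support_iff] at hp
    by_contra hm
    refine mul_ne_zero hp.1 hp.2 ?_
    rw [← hc, coeff_single, Finsupp.single_apply, if_neg (Ne.symm hm)]
  have hcard : f.coeff.support.card * g.coeff.support.card = 1 := by
    refine le_antisymm (not_lt.mp fun hlt ↦ ?_) (Nat.mul_pos hf.card_pos hg.card_pos)
    obtain ⟨p, hp, p', hp', hpp, hu, hu'⟩ := TwoUniqueSums.uniqueAdd_of_one_lt_card hlt
    have hp1 := Finset.mem_product.mp hp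
    have := hu' hp1.1 hp1.2 ((sum_eq p hp hu).trans (sum_eq p' hp' hu').symm)
    exact hpp (Prod.ext this.1 this.2)
  obtain ⟨hf1, hg1⟩ := mul_eq_one.mp hcard
  obtain ⟨p, a, ha, hfp⟩ := Finsupp.card_support_eq_one'.mp hf1
  obtain ⟨q, b, hb, hgq⟩ := Finsupp.card_support_eq_one'.mp hg1
  obtain rfl : f = single p a := coeff_injective hfp
  obtain rfl : g = single q b := coeff_injective hgq
  rw [single_mul_single] at h
  have hs : Finsupp.single (p + q) (a * b) = Finsupp.single m r := congrArg coeff h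
  rcases (Finsupp.single_eq_single_iff _ _ _ _).mp hs with h' | h'
  · exact ⟨p, q, a, b, rfl, rfl, h'.1, h'.2⟩
  · exact absurd h'.2 hr

/-- Over `𝔽₂`, the factors in a factorization of a monomial are monomials. -/
lemma exists_single_one_of_mul_eq_single_one {A : Type*} [Add A] [TwoUniqueSums A]
    {f g : AddMonoidAlgebra (ZMod 2) A} {m : A} (h : f * g = single m 1) :
    ∃ p q, f = single p 1 ∧ g = single q 1 ∧ p + q = m := by
  obtain ⟨p, q, a, b, rfl, rfl, hm, hab⟩ := exists_single_of_mul_eq_single one_ne_zero h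
  have key : ∀ a b : ZMod 2, a * b = 1 → a = 1 ∧ b = 1 := by decide
  obtain ⟨rfl, rfl⟩ := key a b hab
  exact ⟨p, q, rfl, rfl, hm⟩

end AddMonoidAlgebra

instance inst_s13 : TwoUniqueSums ExpMonoid :=
  have : TwoUniqueSums ℚ≥0 := inferInstance
  have : TwoUniqueSums (ℚ≥0 × (ℕ → ℚ≥0)) := inferInstance
  have : TwoUniqueSums (ℚ≥0 × ℚ≥0 × (ℕ → ℚ≥0)) := Prod.instTwoUniqueSums
  Prod.instTwoUniqueSums

/-- Every exponent occurring in an element of `R` with trivial `X`, `Y`, `Z` parts is zero. -/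
lemma eq_zero_of_mem_support_of_mem_RSub {x : RZero} (hx : x ∈ RSub) :
    ∀ m ∈ x.coeff.support, m.1 = 0 → m.2.1 = 0 → m.2.2.1 = 0 → m = 0 := by
  classical
  have single_case : ∀ (n : ExpMonoid) (r : ZMod 2),
      (n.1 = 0 → n.2.1 = 0 → n.2.2.1 = 0 → n = 0) →
      ∀ m ∈ (AddMonoidAlgebra.single n r : RZero).coeff.support,
        m.1 = 0 → m.2.1 = 0 → m.2.2.1 = 0 → m = 0 := by
    intro n r hn m hm
    obtain rfl := Finset.mem_singleton.mp (Finsupp.support_single_subset hm)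
    exact hn
  induction hx using Algebra.adjoin_induction with
  | mem x hx =>
    rcases hx with ⟨α, rfl⟩ | ⟨α, rfl⟩ | ⟨α, rfl⟩ | ⟨α, t, hα, rfl⟩ | ⟨α, t, hα, rfl⟩ |
      ⟨α, t, hα, rfl⟩ <;> apply single_case <;> intro h1 h2 h3
    · exact Prod.ext h1 rfl
    · exact Prod.ext rfl (Prod.ext h2 rfl)
    · exact Prod.ext rfl (Prod.ext rfl (Prod.ext h3 rfl))
    · exact absurd h1 hα.ne'
    · exact absurd h2 hα.ne'
    · exact absurd h3 hα.ne'
  | algebraMap r => exact single_case 0 r fun _ _ _ ↦ rfl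
  | add x y _ _ hx hy =>
    intro m hm
    rcases Finset.mem_union.mp (Finsupp.support_add hm) with h | h
    · exact hx m h
    · exact hy m h
  | mul x y _ _ hx hy =>
    intro m hm h1 h2 h3
    obtain ⟨p, hp, q, hq, rfl⟩ :=
      Finset.mem_add.mp (AddMonoidAlgebra.support_coeff_mul_subset x y hm)
    obtain ⟨hp1, hq1⟩ := add_eq_zero.mp h1
    obtain ⟨hp2, hq2⟩ := add_eq_zero.mp h2
    obtain ⟨hp3, hq3⟩ := add_eq_zero.mp h3
    rw [hx p hp hp1 hp2 hp3, hy q hq hq1 hq2 hq3, add_zero]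

lemma single_X_mem_RSub (t : ℕ → ℚ≥0) :
    (AddMonoidAlgebra.single (1, 0, 0, t) 1 : RZero) ∈ RSub :=
  Algebra.subset_adjoin (Or.inr (Or.inr (Or.inr (Or.inl ⟨1, t, one_pos, rfl⟩))))

lemma single_Y_mem_RSub (t : ℕ → ℚ≥0) :
    (AddMonoidAlgebra.single (0, 1, 0, t) 1 : RZero) ∈ RSub :=
  Algebra.subset_adjoin (Or.inr (Or.inr (Or.inr (Or.inr (Or.inl ⟨1, t, one_pos, rfl⟩)))))

lemma single_Z_mem_RSub (t : ℕ → ℚ≥0) :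
    (AddMonoidAlgebra.single (0, 0, 1, t) 1 : RZero) ∈ RSub :=
  Algebra.subset_adjoin (Or.inr (Or.inr (Or.inr (Or.inr (Or.inr ⟨1, t, one_pos, rfl⟩)))))

lemma single_X_mul_single_Y {t u v : ℕ → ℚ≥0} (h : t + u = v) :
    (AddMonoidAlgebra.single (1, 0, 0, t) 1 * AddMonoidAlgebra.single (0, 1, 0, u) 1 : RZero) =
      AddMonoidAlgebra.single (1, 1, 0, v) 1 := by
  simp [AddMonoidAlgebra.single_mul_single, h]

lemma single_X_mul_single_Z {t u v : ℕ → ℚ≥0} (h : t + u = v) :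
    (AddMonoidAlgebra.single (1, 0, 0, t) 1 * AddMonoidAlgebra.single (0, 0, 1, u) 1 : RZero) =
      AddMonoidAlgebra.single (1, 0, 1, v) 1 := by
  simp [AddMonoidAlgebra.single_mul_single, h]

/-- A common divisor in `R` of `X Y ∏_i T_i ^ v i` and `X Z ∏_i T_i ^ v i` that is divisible by a
monomial `X ∏_i T_i ^ t i` equals that monomial. -/
lemma eq_of_dvd_of_dvd_of_dvd {t v : ℕ → ℚ≥0} {b d sy sz : RSub}
    (hb : (b : RZero) = AddMonoidAlgebra.single (1, 0, 0, t) 1)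
    (hsy : (sy : RZero) = AddMonoidAlgebra.single (1, 1, 0, v) 1)
    (hsz : (sz : RZero) = AddMonoidAlgebra.single (1, 0, 1, v) 1)
    (hy : d ∣ sy) (hz : d ∣ sz) (hbd : b ∣ d) : b = d := by
  obtain ⟨u, rfl⟩ := hbd
  obtain ⟨y, rfl⟩ := hy
  obtain ⟨z, rfl⟩ := hz
  obtain ⟨D, E, hD, -, hDE⟩ := AddMonoidAlgebra.exists_single_one_of_mul_eq_single_one
    (show ((b * u : RSub) : RZero) * (y : RZero) = _ from hsy)
  obtain ⟨D', E', hD', -, hDE'⟩ := AddMonoidAlgebra.exists_single_one_of_mul_eq_single_one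
    (show ((b * u : RSub) : RZero) * (z : RZero) = _ from hsz)
  obtain rfl : D = D' := AddMonoidAlgebra.single_left_injective one_ne_zero (hD.symm.trans hD')
  obtain ⟨B, q, hB, hq, hBq⟩ := AddMonoidAlgebra.exists_single_one_of_mul_eq_single_one
    (show (b : RZero) * (u : RZero) = _ from hD)
  obtain rfl : B = (1, 0, 0, t) :=
    AddMonoidAlgebra.single_left_injective one_ne_zero (hB.symm.trans hb)
  subst hBq
  have hq0 : q = 0 := by
    refine eq_zero_of_mem_support_of_mem_RSub u.2 q (by simp [hq]) ?_ ?_ ?_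
    · have h : 1 + q.1 + E.1 = 1 := congrArg (fun m : ExpMonoid ↦ m.1) hDE
      rw [add_assoc, add_eq_left] at h
      exact (add_eq_zero.mp h).1
    · have h : 0 + q.2.1 + E'.2.1 = 0 := congrArg (fun m : ExpMonoid ↦ m.2.1) hDE'
      rw [zero_add] at h
      exact (add_eq_zero.mp h).1
    · have h : 0 + q.2.2.1 + E.2.2.1 = 0 := congrArg (fun m : ExpMonoid ↦ m.2.2.1) hDE
      rw [zero_add] at h
      exact (add_eq_zero.mp h).1
  have hu : u = 1 := Subtype.ext (by rw [hq, hq0]; rfl)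
  rw [hu, mul_one]

/-- There are elements `s_y = X Y ∏_i T_i`, `s_z = X Z ∏_i T_i` of `R` and, for each
`i ∈ ℕ`, an element `b i = X ∏_{j ≠ i} T_j` of `R`, such that each `b i` is a maximal
common divisor of the pair `{s_y, s_z}` in `R`, and `b i`, `b j` are non-associate
for `i ≠ j`. -/
theorem stmt13 :
    ∃ (sy sz : ↥RSub) (b : ℕ → ↥RSub),
      (sy : RZero) = AddMonoidAlgebra.single (1, 1, 0, fun _ => 1) 1 ∧
      (sz : RZero) = AddMonoidAlgebra.single (1, 0, 1, fun _ => 1) 1 ∧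
      (∀ i : ℕ,
        (b i : RZero) = AddMonoidAlgebra.single (1, 0, 0, fun j => if j = i then 0 else 1) 1) ∧
      (∀ i : ℕ, b i ∣ sy ∧ b i ∣ sz ∧
        ∀ d' : ↥RSub, d' ∣ sy → d' ∣ sz → b i ∣ d' → Associated (b i) d') ∧
      (∀ i j : ℕ, i ≠ j → ¬ Associated (b i) (b j)) := by
  have hsum : ∀ i : ℕ, ((fun j ↦ if j = i then 0 else 1) + (fun j ↦ if j = i then 1 else 0) :
      ℕ → ℚ≥0) = fun _ ↦ 1 := by
    intro i
    funext j
    by_cases h : j = i <;> simp [h]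
  have hsy := RSub.mul_mem (single_X_mem_RSub 0) (single_Y_mem_RSub fun _ ↦ 1)
  have hsz := RSub.mul_mem (single_X_mem_RSub 0) (single_Z_mem_RSub fun _ ↦ 1)
  rw [single_X_mul_single_Y (zero_add _)] at hsy
  rw [single_X_mul_single_Z (zero_add _)] at hsz
  refine ⟨⟨_, hsy⟩, ⟨_, hsz⟩,
    fun i ↦ ⟨_, single_X_mem_RSub fun j ↦ if j = i then 0 else 1⟩,
    rfl, rfl, fun _ ↦ rfl, fun i ↦ ⟨?_, ?_, ?_⟩, ?_⟩
  · exact ⟨⟨_, single_Y_mem_RSub fun j ↦ if j = i then 1 else 0⟩,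
      Subtype.ext (single_X_mul_single_Y (hsum i)).symm⟩
  · exact ⟨⟨_, single_Z_mem_RSub fun j ↦ if j = i then 1 else 0⟩,
      Subtype.ext (single_X_mul_single_Z (hsum i)).symm⟩
  · intro d hy hz hbd
    rw [eq_of_dvd_of_dvd_of_dvd rfl rfl rfl hy hz hbd]
  · intro i j hij h
    obtain ⟨u, hu⟩ := h.dvd
    obtain ⟨B, q, hB, -, hBq⟩ := AddMonoidAlgebra.exists_single_one_of_mul_eq_single_one
      (congrArg Subtype.val hu).symm
    obtain rfl := AddMonoidAlgebra.single_left_injective one_ne_zero hB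
    have hj : (if j = i then 0 else 1) + q.2.2.2 j = if j = j then 0 else 1 :=
      congrArg (fun m : ExpMonoid ↦ m.2.2.2 j) hBq
    rw [if_neg hij.symm, if_pos rfl] at hj
    exact one_ne_zero (add_eq_zero.mp hj).1
end

section
/- Let R₀ = 𝔽₂[M] where M = ℚ≥0 × ℚ≥0 × ℚ≥0 × (ℕ → ℚ≥0), and let R be the 𝔽₂-subalgebra of R₀ generated by the monomials X^α, Y^α, Z^α for α ∈ ℚ≥0 together with all monomials X^α ∏_i T_i^{t(i)}, Y^α ∏_i T_i^{t(i)}, Z^α ∏_i T_i^{t(i)} with α ∈ ℚ, α > 0, and t : ℕ → ℚ≥0. Then R is an antimatter domain, i.e., R contains no irreducible elements. -/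
/-- Every generator of `R` is the square of a generator. -/
theorem exists_mul_self_of_mem_genSet {x : RZero} (hx : x ∈ GenSet) :
    ∃ y ∈ GenSet, x = y * y := by
  have half (t : ℕ → ℚ≥0) : (fun i => t i / 2) + (fun i => t i / 2) = t :=
    funext fun i => add_halves (t i)
  rcases hx with ⟨α, rfl⟩ | ⟨α, rfl⟩ | ⟨α, rfl⟩ | ⟨α, t, hα, rfl⟩ | ⟨α, t, hα, rfl⟩ |
    ⟨α, t, hα, rfl⟩
  · refine ⟨_, Or.inl ⟨α / 2, rfl⟩, ?_⟩
    simp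
  · refine ⟨_, Or.inr <| Or.inl ⟨α / 2, rfl⟩, ?_⟩
    simp
  · refine ⟨_, Or.inr <| Or.inr <| Or.inl ⟨α / 2, rfl⟩, ?_⟩
    simp
  · refine ⟨_, Or.inr <| Or.inr <| Or.inr <| Or.inl
      ⟨α / 2, fun i => t i / 2, half_pos hα, rfl⟩, ?_⟩
    simp [half]
  · refine ⟨_, Or.inr <| Or.inr <| Or.inr <| Or.inr <| Or.inl
      ⟨α / 2, fun i => t i / 2, half_pos hα, rfl⟩, ?_⟩
    simp [half]
  · refine ⟨_, Or.inr <| Or.inr <| Or.inr <| Or.inr <| Or.inr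
      ⟨α / 2, fun i => t i / 2, half_pos hα, rfl⟩, ?_⟩
    simp [half]

/-- Every element of `R` is the square of an element of `R`. -/
theorem exists_mul_self_of_mem_rSub {x : RZero} (hx : x ∈ RSub) :
    ∃ y ∈ RSub, x = y * y := by
  induction hx using Algebra.adjoin_induction with
  | mem x hx =>
    obtain ⟨y, hy, rfl⟩ := exists_mul_self_of_mem_genSet hx
    exact ⟨y, Algebra.subset_adjoin hy, rfl⟩
  | algebraMap r =>
    refine ⟨_, RSub.algebraMap_mem r, ?_⟩
    rw [← map_mul, ← pow_two, ZMod.pow_card]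
  | add x y _ _ hx hy =>
    obtain ⟨u, hu, rfl⟩ := hx
    obtain ⟨v, hv, rfl⟩ := hy
    have : CharP RZero 2 := charP_of_injective_algebraMap' (ZMod 2) 2
    exact ⟨u + v, add_mem hu hv, (CharTwo.add_mul_self u v).symm⟩
  | mul x y _ _ hx hy =>
    obtain ⟨u, hu, rfl⟩ := hx
    obtain ⟨v, hv, rfl⟩ := hy
    exact ⟨u * v, mul_mem hu hv, mul_mul_mul_comm u u v v⟩

/-- `R` is an antimatter domain: it contains no irreducible elements. -/
theorem stmt15 : ∀ a : ↥RSub, ¬ Irreducible a := by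
  rintro ⟨x, hx⟩ h
  obtain ⟨y, hy, hxy⟩ := exists_mul_self_of_mem_rSub hx
  have hsq : (⟨x, hx⟩ : ↥RSub) = ⟨y, hy⟩ * ⟨y, hy⟩ := Subtype.ext hxy
  have hu : IsUnit (⟨y, hy⟩ : ↥RSub) := (h.isUnit_or_isUnit hsq).elim id id
  exact h.not_isUnit (hsq ▸ hu.mul hu)
end

section
/- Let R₀ = 𝔽₂[M] where M = ℚ≥0 × ℚ≥0 × ℚ≥0 × (ℕ → ℚ≥0), and let R be the 𝔽₂-subalgebra of R₀ generated by the monomials X^α, Y^α, Z^α for α ∈ ℚ≥0 together with all monomials X^α ∏_i T_i^{t(i)}, Y^α ∏_i T_i^{t(i)}, Z^α ∏_i T_i^{t(i)} with α ∈ ℚ, α > 0, and t : ℕ → ℚ≥0. Then R is an IDF domain. -/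
/-- `D` is an IDF domain if every nonzero element of `D` has only finitely many
irreducible divisors up to associates. -/
def IsIDFDomain (D : Type*) [CommRing D] : Prop :=
  ∀ a : D, a ≠ 0 → ∃ S : Finset D, (∀ s ∈ S, Irreducible s) ∧
    ∀ d : D, Irreducible d → d ∣ a → ∃ s ∈ S, Associated d s

/-- Halving the exponent of a monomial gives a square root. -/
theorem single_half_mul_self {m n : ExpMonoid} (h : m + m = n) :
    (AddMonoidAlgebra.single m 1 : RZero) * AddMonoidAlgebra.single m 1 =
      AddMonoidAlgebra.single n 1 := by
  rw [AddMonoidAlgebra.single_mul_single, h, one_mul]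

/-- Every generating monomial is the square of a generating monomial. -/
theorem exists_mem_genSet_mul_self {x : RZero} (hx : x ∈ GenSet) :
    ∃ y ∈ GenSet, y * y = x := by
  have half (t : ℕ → ℚ≥0) : (fun i => t i / 2) + (fun i => t i / 2) = t :=
    funext fun i => add_halves (t i)
  rcases hx with ⟨α, rfl⟩ | ⟨α, rfl⟩ | ⟨α, rfl⟩ | ⟨α, t, hα, rfl⟩ | ⟨α, t, hα, rfl⟩ |
    ⟨α, t, hα, rfl⟩
  · exact ⟨_, Or.inl ⟨α / 2, rfl⟩, single_half_mul_self (by simp)⟩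
  · exact ⟨_, Or.inr (Or.inl ⟨α / 2, rfl⟩), single_half_mul_self (by simp)⟩
  · exact ⟨_, Or.inr (Or.inr (Or.inl ⟨α / 2, rfl⟩)), single_half_mul_self (by simp)⟩
  · exact ⟨_, Or.inr (Or.inr (Or.inr (Or.inl ⟨α / 2, fun i => t i / 2, half_pos hα, rfl⟩))),
      single_half_mul_self (by simp [half])⟩
  · exact ⟨_, Or.inr (Or.inr (Or.inr (Or.inr (Or.inl
      ⟨α / 2, fun i => t i / 2, half_pos hα, rfl⟩)))), single_half_mul_self (by simp [half])⟩
  · exact ⟨_, Or.inr (Or.inr (Or.inr (Or.inr (Or.inr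
      ⟨α / 2, fun i => t i / 2, half_pos hα, rfl⟩)))), single_half_mul_self (by simp [half])⟩

/-- Every element of `R` is a square in `R`. -/
theorem exists_mem_rSub_mul_self {x : RZero} (hx : x ∈ RSub) : ∃ y ∈ RSub, y * y = x := by
  have : CharP RZero 2 := charP_of_injective_algebraMap (algebraMap (ZMod 2) RZero).injective 2
  induction hx using Algebra.adjoin_induction with
  | mem x hx =>
    obtain ⟨y, hy, hyx⟩ := exists_mem_genSet_mul_self hx
    exact ⟨y, Algebra.subset_adjoin hy, hyx⟩
  | algebraMap r =>
    refine ⟨algebraMap _ _ r, RSub.algebraMap_mem r, ?_⟩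
    rw [← map_mul, ← pow_two, ZMod.pow_card]
  | add x y _ _ hx hy =>
    obtain ⟨u, hu, rfl⟩ := hx
    obtain ⟨v, hv, rfl⟩ := hy
    exact ⟨u + v, add_mem hu hv, CharTwo.add_mul_self u v⟩
  | mul x y _ _ hx hy =>
    obtain ⟨u, hu, rfl⟩ := hx
    obtain ⟨v, hv, rfl⟩ := hy
    exact ⟨u * v, mul_mem hu hv, mul_mul_mul_comm u v u v⟩

/-- `R` has no irreducible elements. -/
theorem not_irreducible_rSub (d : RSub) : ¬ Irreducible d := by
  obtain ⟨y, hy, hyd⟩ := exists_mem_rSub_mul_self d.2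
  exact fun hd => hd.not_isSquare ⟨⟨y, hy⟩, Subtype.ext hyd.symm⟩

/-- `R` is an IDF domain. -/
theorem stmt16 : IsIDFDomain ↥RSub := by
  intro a _
  exact ⟨∅, by simp, fun d hd _ => (not_irreducible_rSub d hd).elim⟩
end

section
/- There exists a commutative integral domain D that is a GL-domain and an IDF domain such that the polynomial ring D[x] is not an IDF domain; that is, the IDF property does not ascend to polynomial extensions in the class of GL-domains. -/
open Polynomial

theorem isPrimitivePoly_iff_isPrimitive {D : Type*} [CommRing D] {f : D[X]} :
    IsPrimitivePoly f ↔ f.IsPrimitive := by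
  simp only [IsPrimitivePoly, Polynomial.IsPrimitive, C_dvd_iff_dvd_coeff]

namespace IsPRadical

variable {R T : Type*} [CommRing R] [CommRing T]

section General

variable (i : R →+* T) (p : ℕ)

theorem exists_forall_pow_mem_range [IsPRadical i p] (t : T) :
    ∃ N, ∀ n ≥ N, ∃ r, i r = t ^ p ^ n := by
  obtain ⟨N, r, hr⟩ := IsPRadical.pow_mem i p t
  refine ⟨N, fun n hn ↦ ⟨r ^ p ^ (n - N), ?_⟩⟩
  rw [map_pow, hr, ← pow_mul, ← pow_add, Nat.add_sub_cancel' hn]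

theorem exists_forall_map_eq [ExpChar T p] [IsPRadical i p] (f : T[X]) :
    ∃ N, ∀ n ≥ N, ∃ F : R[X], F.map i = f.map (iterateFrobenius T p n) := by
  induction f using Polynomial.induction_on' with
  | add f g hf hg =>
    obtain ⟨N, hN⟩ := hf
    obtain ⟨M, hM⟩ := hg
    refine ⟨max N M, fun n hn ↦ ?_⟩
    obtain ⟨F, hF⟩ := hN n (le_of_max_le_left hn)
    obtain ⟨G, hG⟩ := hM n (le_of_max_le_right hn)
    exact ⟨F + G, by simp [hF, hG]⟩
  | monomial m t =>
    obtain ⟨N, hN⟩ := exists_forall_pow_mem_range i p t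
    refine ⟨N, fun n hn ↦ ?_⟩
    obtain ⟨r, hr⟩ := hN n hn
    exact ⟨monomial m r, by simp [hr, iterateFrobenius_def]⟩

end General

variable {i : R →+* T} (p : ℕ) [Fact p.Prime] [IsPRadical i p]

include p

theorem isUnit_of_isUnit_map (hi : Function.Injective i) {r : R} (hr : IsUnit (i r)) :
    IsUnit r := by
  obtain ⟨v, hv⟩ := hr.exists_right_inv
  obtain ⟨n, w, hw⟩ := IsPRadical.pow_mem i p v
  refine (isUnit_pow_iff (pow_ne_zero n (Fact.out : p.Prime).ne_zero)).mp
    (IsUnit.of_mul_eq_one w (hi ?_))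
  rw [map_mul, map_pow, hw, ← mul_pow, hv, one_pow, map_one]

theorem isDomain [IsDomain R] [IsReduced T] (hi : Function.Injective i) : IsDomain T := by
  have : Nontrivial T := hi.nontrivial
  have : NoZeroDivisors T := by
    refine ⟨fun {x y} hxy ↦ ?_⟩
    obtain ⟨n, r, hr⟩ := IsPRadical.pow_mem i p x
    obtain ⟨m, s, hs⟩ := IsPRadical.pow_mem i p y
    have hn := pow_ne_zero n (Fact.out : p.Prime).ne_zero
    have hm := pow_ne_zero m (Fact.out : p.Prime).ne_zero
    have h : r ^ p ^ m * s ^ p ^ n = 0 := hi (by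
      rw [map_mul, map_pow, map_pow, hr, hs, ← pow_mul, ← pow_mul, mul_comm (p ^ m), ← mul_pow,
        hxy, map_zero, zero_pow (mul_ne_zero hn hm)])
    rcases mul_eq_zero.mp h with h | h
    · rw [eq_zero_of_pow_eq_zero h, map_zero] at hr
      exact .inl (eq_zero_of_pow_eq_zero hr.symm)
    · rw [eq_zero_of_pow_eq_zero h, map_zero] at hs
      exact .inr (eq_zero_of_pow_eq_zero hs.symm)
  exact NoZeroDivisors.to_isDomain T

theorem isRelPrime_map [IsDomain R] [DecompositionMonoid R] (hi : Function.Injective i) {a b : R}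
    (hab : IsRelPrime a b) : IsRelPrime (i a) (i b) := by
  rintro t ⟨s, hs⟩ ⟨s', hs'⟩
  obtain ⟨N₁, h₁⟩ := exists_forall_pow_mem_range i p t
  obtain ⟨N₂, h₂⟩ := exists_forall_pow_mem_range i p s
  obtain ⟨N₃, h₃⟩ := exists_forall_pow_mem_range i p s'
  obtain ⟨r, hr⟩ := h₁ (N₁ + N₂ + N₃) (by lia)
  obtain ⟨u, hu⟩ := h₂ (N₁ + N₂ + N₃) (by lia)
  obtain ⟨v, hv⟩ := h₃ (N₁ + N₂ + N₃) (by lia)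
  have hr_unit : IsUnit r := hab.pow (m := p ^ (N₁ + N₂ + N₃)) (n := p ^ (N₁ + N₂ + N₃))
    ⟨u, hi (by rw [map_pow, map_mul, hr, hu, hs, mul_pow])⟩
    ⟨v, hi (by rw [map_pow, map_mul, hr, hv, hs', mul_pow])⟩
  refine (isUnit_pow_iff (pow_ne_zero (N₁ + N₂ + N₃) (Fact.out : p.Prime).ne_zero)).mp ?_
  exact hr ▸ hr_unit.map i

variable [CharP T p] [PerfectRing T p]

theorem not_isPrimitive_of_C_dvd (hi : Function.Injective i) {q : R} (hq : ¬ IsUnit q) {n : ℕ}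
    {f : T[X]} {F : R[X]} (hF : F.map i = f.map (iterateFrobenius T p n)) (hqF : C q ∣ F) :
    ¬ f.IsPrimitive := by
  intro hf
  obtain ⟨e, he⟩ := (bijective_iterateFrobenius T p n).2 (i q)
  refine hq (isUnit_of_isUnit_map p hi (he ▸ (hf e ?_).map _))
  rw [C_dvd_iff_dvd_coeff] at hqF ⊢
  intro k
  rw [← map_dvd_iff (iterateFrobeniusEquiv T p n)]
  have h := map_dvd i (hqF k)
  rwa [← coeff_map, hF, coeff_map, ← he] at h

theorem isGLDomain [IsDomain R] [UniqueFactorizationMonoid R] (hi : Function.Injective i)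
    [IsDomain T] : IsGLDomain T := by
  intro f g hf hg
  rw [isPrimitivePoly_iff_isPrimitive] at hf hg ⊢
  rintro d ⟨h, hd⟩
  obtain ⟨N₁, h₁⟩ := exists_forall_map_eq i p f
  obtain ⟨N₂, h₂⟩ := exists_forall_map_eq i p g
  obtain ⟨N₃, h₃⟩ := exists_forall_map_eq i p h
  obtain ⟨N₄, h₄⟩ := exists_forall_pow_mem_range i p d
  obtain ⟨n, hn⟩ : ∃ n, n = N₁ + N₂ + N₃ + N₄ := ⟨_, rfl⟩
  obtain ⟨F, hF⟩ := h₁ n (by lia)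
  obtain ⟨G, hG⟩ := h₂ n (by lia)
  obtain ⟨H, hH⟩ := h₃ n (by lia)
  obtain ⟨r, hr⟩ := h₄ n (by lia)
  have hFG : F * G = C r * H := map_injective i hi (by
    rw [Polynomial.map_mul, Polynomial.map_mul, hF, hG, hH, ← Polynomial.map_mul, hd,
      Polynomial.map_mul, map_C, map_C, hr, iterateFrobenius_def])
  have hd0 : d ≠ 0 := by
    rintro rfl
    rw [C_0, zero_mul, mul_eq_zero] at hd
    exact hd.elim hf.ne_zero hg.ne_zero
  have hr0 : r ≠ 0 := by
    rintro rfl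
    exact pow_ne_zero _ hd0 (hr.symm.trans (map_zero i))
  by_contra hdu
  have hru : ¬ IsUnit r := fun hru ↦ hdu
    ((isUnit_pow_iff (pow_ne_zero n (Fact.out : p.Prime).ne_zero)).mp (hr ▸ hru.map i))
  obtain ⟨q, hq, hqr⟩ := WfDvdMonoid.exists_irreducible_factor hru hr0
  have hqFG : C q ∣ F * G := hFG ▸ (map_dvd C hqr).mul_right H
  rcases (prime_C_iff.mpr hq.prime).dvd_or_dvd hqFG with h | h
  · exact not_isPrimitive_of_C_dvd p hi hq.not_isUnit hF h hf
  · exact not_isPrimitive_of_C_dvd p hi hq.not_isUnit hG h hg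

end IsPRadical

section Pullback

variable {T K : Type*} [CommRing T] [Field K] {π : T →+* K} {k : Subfield K}

theorem isUnit_subring_comap_iff {d : k.toSubring.comap π} : IsUnit d ↔ IsUnit (d : T) := by
  refine ⟨fun h ↦ h.map (k.toSubring.comap π).subtype, fun h ↦ ?_⟩
  obtain ⟨e, he⟩ := h.exists_right_inv
  have hπ : π e = (π d)⁻¹ := eq_inv_of_mul_eq_one_right (by rw [← map_mul, he, map_one])
  refine IsUnit.of_mul_eq_one ⟨e, ?_⟩ (Subtype.ext he)
  change π e ∈ k
  exact hπ ▸ inv_mem d.2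

variable {c : K →+* T} (hc : ∀ x, π (c x) = x) (hsq : ∀ t : T, IsSquare t)

include hc hsq

theorem not_irreducible_subring_comap (d : k.toSubring.comap π) : ¬ Irreducible d := by
  intro hd
  suffices ∃ s t : k.toSubring.comap π, d = s * t ∧ (IsUnit s → IsUnit d) ∧
      (IsUnit t → IsUnit d) by
    obtain ⟨s, t, hst, hs, ht⟩ := this
    exact hd.not_isUnit ((hd.isUnit_or_isUnit hst).elim hs ht)
  by_cases h0 : π d = 0
  · obtain ⟨s, hs⟩ := hsq d
    have hπs : π s = 0 := by
      rw [hs, map_mul, mul_self_eq_zero] at h0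
      exact h0
    have hsk : s ∈ k.toSubring.comap π := by
      change π s ∈ k
      exact hπs ▸ zero_mem k
    have hds : d = ⟨s, hsk⟩ * ⟨s, hsk⟩ := Subtype.ext hs
    exact ⟨⟨s, hsk⟩, ⟨s, hsk⟩, hds, fun h ↦ hds ▸ h.mul h, fun h ↦ hds ▸ h.mul h⟩
  · obtain ⟨s, hs⟩ := hsq (c (π d)⁻¹ * d)
    have hd_eq : (d : T) = c (π d) * (s * s) := by
      rw [← hs, ← mul_assoc, ← map_mul, mul_inv_cancel₀ h0, map_one, one_mul]
    have hπs : π s * π s = 1 := by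
      rw [← map_mul, ← hs, map_mul, hc, inv_mul_cancel₀ h0]
    have hsk : π s ∈ k := by
      rcases mul_self_eq_one_iff.mp hπs with h | h
      · exact h ▸ one_mem k
      · exact h ▸ neg_mem (one_mem k)
    have hcu : IsUnit (c (π d)) := (isUnit_iff_ne_zero.mpr h0).map c
    have hcs : c (π d) * s ∈ k.toSubring.comap π := by
      change π (c (π d) * s) ∈ k
      rw [map_mul, hc]
      exact mul_mem d.2 hsk
    refine ⟨⟨_, hcs⟩, ⟨s, hsk⟩, Subtype.ext (hd_eq.trans (mul_assoc _ _ _).symm), ?_, ?_⟩ <;>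
    · simp only [isUnit_subring_comap_iff]
      intro h
      have hsu : IsUnit s := by
        first | exact h | exact isUnit_of_mul_isUnit_right h
      exact hd_eq ▸ hcu.mul (hsu.mul hsu)

theorem isIDFDomain_subring_comap : IsIDFDomain (k.toSubring.comap π) := fun _ _ ↦
  ⟨∅, by simp, fun d hd ↦ (not_irreducible_subring_comap hc hsq d hd).elim⟩

theorem isPrimitive_map_subtype_iff {f : (k.toSubring.comap π)[X]} :
    (f.map (k.toSubring.comap π).subtype).IsPrimitive ↔ f.IsPrimitive := by
  refine ⟨fun hf d hd ↦ isUnit_subring_comap_iff.mpr (hf d ?_), fun hf t ht ↦ ?_⟩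
  · simpa using! Polynomial.map_dvd (k.toSubring.comap π).subtype hd
  rw [C_dvd_iff_dvd_coeff] at ht
  suffices ∃ d : k.toSubring.comap π, (IsUnit (d : T) → IsUnit t) ∧
      ∀ n, ∃ s, π s ∈ k ∧ (f.coeff n : T) = d * s by
    obtain ⟨d, hdt, hd⟩ := this
    refine hdt (isUnit_subring_comap_iff.mp (hf d ((C_dvd_iff_dvd_coeff _ _).mpr fun n ↦ ?_)))
    obtain ⟨s, hs, hfs⟩ := hd n
    exact ⟨⟨s, hs⟩, Subtype.ext hfs⟩
  by_cases h0 : π t = 0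
  · obtain ⟨s, rfl⟩ := hsq t
    have hπs : π s = 0 := by rwa [map_mul, mul_self_eq_zero] at h0
    refine ⟨⟨s, ?_⟩, fun h ↦ h.mul h, fun n ↦ ?_⟩
    · change π s ∈ k
      exact hπs ▸ zero_mem k
    · obtain ⟨v, hv⟩ := ht n
      refine ⟨s * v, by simp [hπs], ?_⟩
      rw [← mul_assoc, ← hv, coeff_map]
      rfl
  · have hπ : π (c (π t)⁻¹ * t) = 1 := by rw [map_mul, hc, inv_mul_cancel₀ h0]
    refine ⟨⟨c (π t)⁻¹ * t, ?_⟩, fun h ↦ isUnit_of_mul_isUnit_right h, fun n ↦ ?_⟩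
    · change π _ ∈ k
      exact hπ ▸ one_mem k
    · obtain ⟨v, hv⟩ := ht n
      have hfv : (f.coeff n : T) = c (π t)⁻¹ * t * (c (π t) * v) := by
        have hcc : c (π t)⁻¹ * c (π t) = 1 := by
          rw [← map_mul, inv_mul_cancel₀ h0, map_one]
        calc (f.coeff n : T) = t * v := by rw [← hv, coeff_map]; rfl
          _ = (c (π t)⁻¹ * c (π t)) * (t * v) := by rw [hcc, one_mul]
          _ = _ := by ring
      refine ⟨_, ?_, hfv⟩
      have hk : π (f.coeff n) ∈ k := (f.coeff n).2
      rwa [hfv, map_mul, hπ, one_mul] at hk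

theorem isGLDomain_subring_comap (hT : IsGLDomain T) : IsGLDomain (k.toSubring.comap π) := by
  intro f g hf hg
  rw [isPrimitivePoly_iff_isPrimitive, ← isPrimitive_map_subtype_iff hc hsq] at hf hg ⊢
  rw [Polynomial.map_mul, ← isPrimitivePoly_iff_isPrimitive]
  rw [← isPrimitivePoly_iff_isPrimitive] at hf hg
  exact hT _ _ hf hg

omit hsq

theorem not_isIDFDomain_polynomial_subring_comap [IsDomain T] {a b : T} (ha : π a = 0)
    (hb : π b = 0) (ha0 : a ≠ 0) (hab : IsRelPrime a b) {ι : Type*} [Infinite ι] (u : ι → K)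
    (hu0 : ∀ i, u i ≠ 0) (hu : ∀ i j, u i / u j ∈ k → i = j) :
    ¬ IsIDFDomain (k.toSubring.comap π)[X] := by
  have mem (x : K) {t : T} (ht : π t = 0) : c x * t ∈ k.toSubring.comap π := by
    change π _ ∈ k
    simp [ht]
  let ℓ (x : K) : (k.toSubring.comap π)[X] := C ⟨c x * a, mem x ha⟩ * X + C ⟨c x * b, mem x hb⟩
  have hℓ_mul (x : K) (hx : x ≠ 0) : ℓ x * ℓ x⁻¹ = ℓ 1 * ℓ 1 := by
    have hcx : c x * c x⁻¹ = 1 := by rw [← map_mul, mul_inv_cancel₀ hx, map_one]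
    apply map_injective (k.toSubring.comap π).subtype Subtype.coe_injective
    have hCcx : (C (c x) * C (c x⁻¹) : T[X]) = 1 := by rw [← C_mul, hcx, C_1]
    simp only [ℓ, Polynomial.map_mul, Polynomial.map_add, map_C, map_X, Subring.subtype_apply,
      map_one, one_mul, C_mul]
    linear_combination (C a * X + C b) ^ 2 * hCcx
  have hℓ_coeff (x : K) : (ℓ x).coeff 1 = ⟨c x * a, mem x ha⟩ := by simp [ℓ]
  have hca (x : K) (hx : x ≠ 0) : c x * a ≠ 0 :=
    mul_ne_zero ((map_ne_zero_iff c c.injective).mpr hx) ha0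
  have hℓ_ne (x : K) (hx : x ≠ 0) : ℓ x ≠ 0 := fun h ↦ hca x hx (by
    have := hℓ_coeff x
    rw [h, coeff_zero] at this
    exact congrArg Subtype.val this.symm)
  have hℓ_irr (x : K) (hx : x ≠ 0) : Irreducible (ℓ x) := by
    refine irreducible_C_mul_X_add_C (fun h ↦ hca x hx (congrArg Subtype.val h)) ?_
    intro d hda hdb
    have hcx : IsUnit (c x) := (isUnit_iff_ne_zero.mpr hx).map c
    refine isUnit_subring_comap_iff.mpr (hab ?_ ?_)
    · exact hcx.dvd_mul_left.mp (map_dvd (k.toSubring.comap π).subtype hda)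
    · exact hcx.dvd_mul_left.mp (map_dvd (k.toSubring.comap π).subtype hdb)
  have hℓ_assoc (i j : ι) (h : Associated (ℓ (u i)) (ℓ (u j))) : i = j := by
    obtain ⟨w, hw⟩ := h.symm
    obtain ⟨v, -, hv⟩ := Polynomial.isUnit_iff.mp w.isUnit
    have h1 : c (u j) * a * v = c (u i) * a := by
      have := congrArg (coeff · 1) hw
      simp only [← hv, coeff_mul_C, hℓ_coeff] at this
      exact congrArg Subtype.val this
    have h2 : c (u j) * v = c (u i) := mul_right_cancel₀ ha0 (by rw [← h1]; ring)
    have h3 : u j * π v = u i := by rw [← hc (u i), ← h2, map_mul, hc]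
    refine hu i j ?_
    rw [← h3, mul_div_cancel_left₀ _ (hu0 j)]
    exact v.2
  intro hIDF
  obtain ⟨S, -, hS⟩ := hIDF (ℓ 1 * ℓ 1)
    (mul_ne_zero (hℓ_ne 1 one_ne_zero) (hℓ_ne 1 one_ne_zero))
  choose s hsS hs using fun i ↦ hS (ℓ (u i)) (hℓ_irr _ (hu0 i)) ⟨_, (hℓ_mul _ (hu0 i)).symm⟩
  obtain ⟨i, j, hij, h⟩ := Finite.exists_ne_map_eq_of_infinite fun i ↦ (⟨s i, hsS i⟩ : S)
  have hsij : s i = s j := congrArg Subtype.val h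
  exact hij (hℓ_assoc i j ((hs i).trans (hsij ▸ (hs j).symm)))

end Pullback

/-- The IDF property does not ascend to polynomial extensions in the class of
GL-domains: there is an integral domain which is a GL-domain and an IDF domain whose
polynomial ring is not an IDF domain. -/
theorem stmt18 :
    ∃ (D : Type) (_ : CommRing D),
      IsDomain D ∧ IsGLDomain D ∧ IsIDFDomain D ∧ ¬ IsIDFDomain (Polynomial D) := by
  let K := AlgebraicClosure (ZMod 2)
  let R := MvPolynomial (Fin 2) K
  let T := PerfectClosure R 2
  let i : R →+* T := PerfectClosure.of R 2
  have hi : Function.Injective i := fun x y h ↦ by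
    simpa using (PerfectClosure.eq_iff R 2 (0, x) (0, y)).mp h
  have : IsDomain T := IsPRadical.isDomain 2 hi
  let π : T →+* K := PerfectClosure.lift R 2 K MvPolynomial.constantCoeff
  have hπ (r : R) : π (i r) = MvPolynomial.constantCoeff r :=
    RingHom.congr_fun ((PerfectClosure.lift R 2 K).symm_apply_apply MvPolynomial.constantCoeff) r
  let c : K →+* T := i.comp MvPolynomial.C
  have hc (x : K) : π (c x) = x := (hπ _).trans (MvPolynomial.constantCoeff_C _ x)
  have hsq (t : T) : IsSquare t := by
    obtain ⟨s, hs⟩ := surjective_frobenius T 2 t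
    exact ⟨s, by rw [← hs, frobenius_def, sq]⟩
  let k : Subfield K := (algebraMap (ZMod 2) K).fieldRange
  have hk (x : Kˣ) (hx : (x : K) ∈ k) : x = 1 := by
    obtain ⟨z, hz⟩ := hx
    have hz1 : z = 1 := by
      have hz0 : z ≠ 0 := by
        rintro rfl
        exact x.ne_zero (hz.symm.trans (map_zero _))
      revert hz0
      clear hz
      revert z
      decide
    exact Units.ext (by rw [← hz, hz1, map_one, Units.val_one])
  have hX (j : Fin 2) : π (i (MvPolynomial.X j)) = 0 :=
    (hπ _).trans (MvPolynomial.constantCoeff_X K j)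
  have hXX : IsRelPrime (MvPolynomial.X 0 : R) (MvPolynomial.X 1) :=
    (MvPolynomial.X_prime.irreducible.isRelPrime_iff_not_dvd).mpr
      (by simp [MvPolynomial.X_dvd_X])
  have : Infinite Kˣ := by
    rw [unitsEquivNeZero.infinite_iff]
    exact (Set.finite_singleton (0 : K)).infinite_compl.to_subtype
  refine ⟨k.toSubring.comap π, inferInstance, inferInstance,
    isGLDomain_subring_comap hc hsq (IsPRadical.isGLDomain 2 hi),
    isIDFDomain_subring_comap hc hsq,
    not_isIDFDomain_polynomial_subring_comap hc (hX 0) (hX 1)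
      ((map_ne_zero_iff i hi).mpr (MvPolynomial.X_ne_zero 0)) (IsPRadical.isRelPrime_map 2 hi hXX)
      (fun x : Kˣ ↦ (x : K)) Units.ne_zero fun x y h ↦ ?_⟩
  rw [← Units.val_div_eq_div_val] at h
  exact div_eq_one.mp (hk _ h)
end
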